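/- arXiv:math/9909180 — 2 statements merged into one kernel-verified Lean document; each statement's English description precedes it below -/
import Mathlib

section
/- Let g : ℕ → ℂ be multiplicative satisfying: (i) ∑_{p≤w} g(p)(log p)/p = κ log w + O(1) for all w ≥ 2, with κ = ξ+iη ∈ ℂ and η² < 2ξ+1; (ii) ∑_p |g(p)|(log p)/p · ∑_{r≥1}|g(p^r)|/p^r + ∑_p ∑_{r≥2} |g(p^r)|(log p^r)/p^r < ∞; (iii) ∏_{p≤x}(1+|g(p)|/p) ≪ (log x)^β for some 0 ≤ β < ξ+1. Then there exists a constant c(g) such that ∑_{n≤x} g(n)/n = c(g)(log x)^κ + O((log x)^{β−1}) for all x ≥ 2, where c(g) = Γ(κ+1)^{-1} ∏_p (1−1/p)^κ (1 + g(p)/p + g(p²)/p² + ⋯), the product converging. -/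
open Finset Filter

/-- The sum of `log m` over `m ≤ n`, written through the von Mangoldt function. -/
lemma log_factorial_eq_sum_vonMangoldt (n : ℕ) :
    Real.log (n.factorial : ℝ) =
      ∑ m ∈ Ioc 0 n, ArithmeticFunction.vonMangoldt m * ((n / m : ℕ) : ℝ) := by
  rw [← ArithmeticFunction.sum_Ioc_mul_zeta_eq_sum, ArithmeticFunction.vonMangoldt_mul_zeta]
  simp only [ArithmeticFunction.log_apply]
  induction n with
  | zero => simp
  | succ n ih =>
    rw [Finset.sum_Ioc_succ_top (Nat.zero_le n), ← ih, Nat.factorial_succ, Nat.cast_mul,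
      Real.log_mul (by positivity) (by positivity), add_comm]

lemma sum_log_div_prime_le {n : ℕ} (hn : 1 ≤ n) :
    ∑ p ∈ (range (n + 1)).filter Nat.Prime, Real.log p / p ≤ Real.log n + Real.log 4 := by
  have hn0 : (0 : ℝ) < n := by exact_mod_cast hn
  have h1 : ∑ p ∈ (range (n + 1)).filter Nat.Prime, Real.log p * (((n / p : ℕ) : ℝ))
      ≤ Real.log (n.factorial : ℝ) := by
    rw [log_factorial_eq_sum_vonMangoldt]
    calc _ = ∑ p ∈ (range (n + 1)).filter Nat.Prime,
          ArithmeticFunction.vonMangoldt p * (((n / p : ℕ) : ℝ)) := by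
          refine sum_congr rfl fun p hp => ?_
          rw [ArithmeticFunction.vonMangoldt_apply_prime (mem_filter.1 hp).2]
      _ ≤ _ := by
          refine sum_le_sum_of_subset_of_nonneg ?_ fun m _ _ =>
            mul_nonneg ArithmeticFunction.vonMangoldt_nonneg (Nat.cast_nonneg _)
          intro p hp
          simp only [mem_filter, mem_range, mem_Ioc] at hp ⊢
          exact ⟨hp.2.pos, by omega⟩
  have h2 : Real.log (n.factorial : ℝ) ≤ n * Real.log n := by
    rw [← Real.log_pow]
    exact Real.log_le_log (by positivity) (by exact_mod_cast Nat.factorial_le_pow n)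
  have h3 : ∑ p ∈ (range (n + 1)).filter Nat.Prime, Real.log p ≤ Real.log 4 * n := by
    refine le_trans (le_of_eq ?_) (Chebyshev.theta_le_log4_mul_x (x := n) (Nat.cast_nonneg n))
    rw [Chebyshev.theta]
    refine sum_congr ?_ fun _ _ => rfl
    ext p
    simp only [mem_filter, mem_range, mem_Ioc, Nat.floor_natCast]
    constructor
    · rintro ⟨h, hp⟩; exact ⟨⟨hp.pos, by omega⟩, hp⟩
    · rintro ⟨h, hp⟩; exact ⟨by omega, hp⟩
  have h4 : n * ∑ p ∈ (range (n + 1)).filter Nat.Prime, Real.log p / p ≤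
      ∑ p ∈ (range (n + 1)).filter Nat.Prime, Real.log p * (((n / p : ℕ) : ℝ)) +
      ∑ p ∈ (range (n + 1)).filter Nat.Prime, Real.log p := by
    rw [mul_sum, ← sum_add_distrib]
    refine sum_le_sum fun p _ => ?_
    have hlog : 0 ≤ Real.log p := Real.log_natCast_nonneg p
    have : (n : ℝ) / p ≤ ((n / p : ℕ) : ℝ) + 1 := by
      rw [← Nat.floor_div_eq_div (K := ℝ)]
      exact (Nat.lt_floor_add_one _).le
    calc (n : ℝ) * (Real.log p / p) = Real.log p * (n / p) := by ring
      _ ≤ Real.log p * (((n / p : ℕ) : ℝ) + 1) := by gcongr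
      _ = _ := by ring
  refine le_of_mul_le_mul_left ?_ hn0
  linarith

lemma exists_log_le_sum_log_div_prime : ∃ C : ℝ, ∀ n : ℕ, 1 ≤ n →
    Real.log n ≤ ∑ p ∈ (range (n + 1)).filter Nat.Prime, Real.log p / p + C := by
  have hs : Summable fun m : ℕ => 4 * (1 / (m : ℝ) ^ (3 / 2 : ℝ)) :=
    (Real.summable_one_div_nat_rpow.2 (by norm_num)).mul_left 4
  refine ⟨1 + ∑' m : ℕ, 4 * (1 / (m : ℝ) ^ (3 / 2 : ℝ)), fun n hn => ?_⟩
  have hn0 : (0 : ℝ) < n := by exact_mod_cast hn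
  have h1 : (n : ℝ) * Real.log n - n ≤ Real.log (n.factorial : ℝ) := by
    have h := Stirling.le_log_factorial_stirling (n := n) (by omega)
    have h' : 0 ≤ Real.log n := Real.log_natCast_nonneg n
    have h'' : 0 ≤ Real.log (2 * Real.pi) :=
      Real.log_nonneg (by nlinarith [Real.pi_gt_three])
    linarith
  have h2 : Real.log (n.factorial : ℝ) ≤
      n * ∑ p ∈ (range (n + 1)).filter Nat.Prime, Real.log p / (p - 1) := by
    rw [Real.log_nat_eq_sum_factorization, Finsupp.sum, Nat.support_factorization, mul_sum]
    calc _ ≤ ∑ p ∈ n.factorial.primeFactors, (n : ℝ) * (Real.log p / (p - 1)) := by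
          refine sum_le_sum fun p hp => ?_
          have hpp := Nat.prime_of_mem_primeFactors hp
          have : Fact p.Prime := ⟨hpp⟩
          have hp1 : (1 : ℝ) < p := by exact_mod_cast hpp.one_lt
          rw [Nat.factorization_def _ hpp]
          have h : (p - 1) * padicValNat p n.factorial ≤ n := by
            rw [sub_one_mul_padicValNat_factorial]; omega
          have h' : ((p : ℝ) - 1) * padicValNat p n.factorial ≤ n := by
            have := (Nat.cast_le (α := ℝ)).2 h
            rwa [Nat.cast_mul, Nat.cast_sub hpp.one_lt.le, Nat.cast_one] at this
          have hlog : 0 ≤ Real.log p := Real.log_natCast_nonneg p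
          rw [mul_div_assoc', le_div_iff₀ (by linarith)]
          nlinarith
      _ ≤ _ := by
          refine sum_le_sum_of_subset_of_nonneg ?_ fun p hp _ => ?_
          · intro p hp
            have hpp := Nat.prime_of_mem_primeFactors hp
            simp only [mem_filter, mem_range]
            have := (Nat.Prime.dvd_factorial hpp).1 (Nat.dvd_of_mem_primeFactors hp)
            exact ⟨by omega, hpp⟩
          · have hp1 : (1 : ℝ) < p := by exact_mod_cast (mem_filter.1 hp).2.one_lt
            exact mul_nonneg hn0.le (div_nonneg (Real.log_nonneg hp1.le) (by linarith))
  have h3 : ∑ p ∈ (range (n + 1)).filter Nat.Prime, Real.log p / (p - 1) ≤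
      ∑ p ∈ (range (n + 1)).filter Nat.Prime, Real.log p / p +
        ∑' m : ℕ, 4 * (1 / (m : ℝ) ^ (3 / 2 : ℝ)) := by
    refine le_trans ?_ (add_le_add_right
      (hs.sum_le_tsum ((range (n + 1)).filter Nat.Prime) fun m _ => by positivity) _)
    rw [← sum_add_distrib]
    refine sum_le_sum fun p hp => ?_
    have hp2 : (2 : ℝ) ≤ p := by exact_mod_cast (mem_filter.1 hp).2.two_le
    have hlog : Real.log p ≤ 2 * (p : ℝ) ^ (1 / 2 : ℝ) := by
      have := Real.log_le_rpow_div (x := p) (ε := 1 / 2) (by linarith) (by norm_num)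
      linarith
    have hpow : (p : ℝ) ^ (3 / 2 : ℝ) * (p : ℝ) ^ (1 / 2 : ℝ) = p ^ 2 := by
      rw [← Real.rpow_add (by linarith), ← Real.rpow_natCast]; norm_num
    have hpos : 0 < (p : ℝ) ^ (3 / 2 : ℝ) := Real.rpow_pos_of_pos (by linarith) _
    have e1 : Real.log p / (p - 1) = Real.log p / p + Real.log p / (p * (p - 1)) := by
      have : (p : ℝ) - 1 ≠ 0 := by linarith
      have : (p : ℝ) ≠ 0 := by linarith
      field_simp
      ring
    rw [e1]
    gcongr
    rw [mul_one_div, div_le_div_iff₀ (by nlinarith) hpos]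
    calc Real.log p * (p : ℝ) ^ (3 / 2 : ℝ)
        ≤ 2 * (p : ℝ) ^ (1 / 2 : ℝ) * (p : ℝ) ^ (3 / 2 : ℝ) := by gcongr
      _ = 2 * p ^ 2 := by rw [← hpow]; ring
      _ ≤ _ := by nlinarith
  refine le_of_mul_le_mul_left ?_ hn0
  nlinarith [mul_le_mul_of_nonneg_left h3 hn0.le]

/-- The first theorem of Mertens, restricted to primes. -/
theorem exists_abs_sum_log_div_prime_sub_log_le : ∃ C : ℝ, ∀ n : ℕ, 1 ≤ n →
    |∑ p ∈ (range (n + 1)).filter Nat.Prime, Real.log p / p - Real.log n| ≤ C := by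
  obtain ⟨C, hC⟩ := exists_log_le_sum_log_div_prime
  refine ⟨max C (Real.log 4), fun n hn => abs_le.2 ⟨?_, ?_⟩⟩
  · linarith [hC n hn, le_max_left C (Real.log 4)]
  · linarith [sum_log_div_prime_le hn, le_max_right C (Real.log 4)]

/-- The logarithmically weighted partial sum `∑_{n ≤ x} a n (log x - log n)`. -/
noncomputable def logWeightedSum (a : ℕ → ℂ) (x : ℝ) : ℂ :=
  ∑ n ∈ Icc 1 ⌊x⌋₊, a n * ((Real.log x - Real.log n : ℝ) : ℂ)

lemma logWeightedSum_exp_eq_sum_max (a : ℕ → ℂ) {N : ℕ} {L : ℝ} (hL : Real.exp L < N + 1) :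
    logWeightedSum a (Real.exp L) =
      ∑ n ∈ Icc 1 N, a n * ((max (L - Real.log n) 0 : ℝ) : ℂ) := by
  rw [logWeightedSum, Real.log_exp]
  have hN : ⌊Real.exp L⌋₊ ≤ N := by
    have : ⌊Real.exp L⌋₊ < N + 1 := (Nat.floor_lt (Real.exp_pos L).le).2 (by exact_mod_cast hL)
    omega
  rw [← sum_subset (Icc_subset_Icc_right hN)]
  · refine sum_congr rfl fun n hn => ?_
    rw [mem_Icc, Nat.le_floor_iff (Real.exp_pos L).le] at hn
    have : Real.log n ≤ L := (Real.log_le_iff_le_exp (by exact_mod_cast hn.1)).2 hn.2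
    rw [max_eq_left (by linarith)]
  · intro n hn hn'
    rw [mem_Icc] at hn
    have h : Real.exp L < n := by
      by_contra h
      exact hn' (mem_Icc.2 ⟨hn.1, Nat.le_floor (not_lt.1 h)⟩)
    have : L < Real.log n := (Real.lt_log_iff_exp_lt (by exact_mod_cast hn.1)).2 h
    rw [max_eq_right (by linarith)]
    simp

lemma continuous_logWeightedSum_exp (a : ℕ → ℂ) :
    Continuous fun L : ℝ => logWeightedSum a (Real.exp L) := by
  refine continuous_iff_continuousAt.2 fun L => ?_
  have h : ∀ᶠ t in nhds L, Real.exp t < (⌊Real.exp L⌋₊ : ℕ) + 1 :=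
    Real.continuous_exp.continuousAt.eventually_lt continuousAt_const (Nat.lt_floor_add_one _)
  refine ContinuousAt.congr (f := fun t : ℝ => ∑ n ∈ Icc 1 ⌊Real.exp L⌋₊,
    a n * ((max (t - Real.log n) 0 : ℝ) : ℂ)) ?_
    (h.mono fun t ht => (logWeightedSum_exp_eq_sum_max a ht).symm)
  refine Continuous.continuousAt (continuous_finsetSum _ fun n _ => ?_)
  fun_prop

lemma hasDerivWithinAt_logWeightedSum_exp (a : ℕ → ℂ) (L : ℝ) :
    HasDerivWithinAt (fun t : ℝ => logWeightedSum a (Real.exp t))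
      (∑ n ∈ Icc 1 ⌊Real.exp L⌋₊, a n) (Set.Ici L) L := by
  have h : ∀ᶠ t in nhds L, Real.exp t < (⌊Real.exp L⌋₊ : ℕ) + 1 :=
    Real.continuous_exp.continuousAt.eventually_lt continuousAt_const (Nat.lt_floor_add_one _)
  have hd : HasDerivAt (fun t : ℝ => ∑ n ∈ Icc 1 ⌊Real.exp L⌋₊,
      a n * ((t - Real.log n : ℝ) : ℂ)) (∑ n ∈ Icc 1 ⌊Real.exp L⌋₊, a n) L := by
    refine HasDerivAt.fun_sum fun n _ => ?_
    have h1 : HasDerivAt (fun t : ℝ => ((t - Real.log n : ℝ) : ℂ)) ((1 : ℝ) : ℂ) L :=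
      ((hasDerivAt_id L).sub_const _).ofReal_comp
    simpa using h1.const_mul (a n)
  refine hd.hasDerivWithinAt.congr_of_eventuallyEq ?_ (by simp [logWeightedSum])
  filter_upwards [self_mem_nhdsWithin, mem_nhdsWithin_of_mem_nhds h] with t ht ht'
  have : ⌊Real.exp t⌋₊ = ⌊Real.exp L⌋₊ := by
    refine le_antisymm ?_ (Nat.floor_mono (Real.exp_le_exp.2 ht))
    have : ⌊Real.exp t⌋₊ < ⌊Real.exp L⌋₊ + 1 :=
      (Nat.floor_lt (Real.exp_pos t).le).2 (by exact_mod_cast ht')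
    omega
  simp only [logWeightedSum, this, Real.log_exp]

/-- Tauberian step: if the partial sums `M(x)` of `a` and their logarithmic averages `T(x)`
satisfy `M(x) log x = (κ + 1) T(x) + O((log x)^β)` with `β < Re κ + 1`, then `M(x)` is
asymptotic to a multiple of `(log x)^κ`. -/
theorem exists_sum_sub_mul_log_cpow_le (a : ℕ → ℂ) (κ : ℂ) (β : ℝ) (hβ : β < κ.re + 1) {C : ℝ}
    (hC : ∀ x : ℝ, 2 ≤ x → ‖(∑ n ∈ Icc 1 ⌊x⌋₊, a n) * (Real.log x : ℂ) -
      (κ + 1) * logWeightedSum a x‖ ≤ C * Real.log x ^ β) :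
    ∃ c : ℂ, ∃ K : ℝ, ∀ x : ℝ, 2 ≤ x →
      ‖(∑ n ∈ Icc 1 ⌊x⌋₊, a n) - c * (Real.log x : ℂ) ^ κ‖ ≤ K * Real.log x ^ (β - 1) := by
  set δ : ℝ := κ.re + 1 - β with hδ
  have hδ0 : 0 < δ := by linarith
  set l : ℝ := Real.log 2 with hl
  have hl0 : 0 < l := Real.log_pos (by norm_num)
  have hexp : ∀ t : ℝ, l ≤ t → 2 ≤ Real.exp t := fun t ht => by
    calc (2 : ℝ) = Real.exp l := (Real.exp_log (by norm_num)).symm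
      _ ≤ _ := Real.exp_le_exp.2 ht
  set f : ℝ → ℂ := fun t => logWeightedSum a (Real.exp t) * (t : ℂ) ^ (-(κ + 1)) with hf
  have hpow : ∀ t : ℝ, 0 < t → HasDerivAt (fun t : ℝ => (t : ℂ) ^ (-(κ + 1)))
      (-(κ + 1) * (t : ℂ) ^ (-(κ + 1) - 1)) t := fun t ht => by
    have := ((hasDerivAt_id (t : ℂ)).cpow_const (c := -(κ + 1))
      (Complex.ofReal_mem_slitPlane.2 ht)).comp_ofReal
    simpa using this
  have hpow1 : ∀ t : ℝ, 0 < t →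
      (t : ℂ) ^ (-(κ + 1)) = (t : ℂ) ^ (-(κ + 1) - 1) * t := fun t ht => by
    have ht' : (t : ℂ) ≠ 0 := by exact_mod_cast ht.ne'
    rw [Complex.cpow_sub _ _ ht', Complex.cpow_one, div_mul_cancel₀ _ ht']
  have hfd : ∀ t : ℝ, 0 < t → HasDerivWithinAt f
      (((∑ n ∈ Icc 1 ⌊Real.exp t⌋₊, a n) * t - (κ + 1) * logWeightedSum a (Real.exp t)) *
        (t : ℂ) ^ (-(κ + 1) - 1)) (Set.Ici t) t := fun t ht => by
    have := (hasDerivWithinAt_logWeightedSum_exp a t).mul (hpow t ht).hasDerivWithinAt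
    refine this.congr_deriv ?_
    rw [hpow1 t ht]
    ring
  have hbound : ∀ t : ℝ, l ≤ t →
      ‖((∑ n ∈ Icc 1 ⌊Real.exp t⌋₊, a n) * t - (κ + 1) * logWeightedSum a (Real.exp t)) *
        (t : ℂ) ^ (-(κ + 1) - 1)‖ ≤ C * t ^ (-δ - 1) := fun t ht => by
    have ht0 : 0 < t := hl0.trans_le ht
    have h := hC _ (hexp t ht)
    rw [Real.log_exp] at h
    rw [norm_mul, Complex.norm_cpow_eq_rpow_re_of_pos ht0]
    calc _ ≤ C * t ^ β * t ^ (-(κ + 1) - 1).re := by gcongr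
      _ = C * t ^ (-δ - 1) := by
        rw [mul_assoc, ← Real.rpow_add ht0]
        congr 2
        simp [hδ]
        ring
  have hfc : ∀ a' b : ℝ, l ≤ a' → ContinuousOn f (Set.Icc a' b) := fun a' b ha t ht =>
    ((continuous_logWeightedSum_exp a).continuousAt.mul
      (hpow t (hl0.trans_le (ha.trans ht.1))).continuousAt).continuousWithinAt
  have hdiff : ∀ s t : ℝ, l ≤ s → s ≤ t → ‖f t - f s‖ ≤ C / δ * s ^ (-δ) := by
    intro s t hs hst
    have hB : ∀ u : ℝ, 0 < u → HasDerivAt (fun u : ℝ => C / δ * (s ^ (-δ) - u ^ (-δ)))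
        (C * u ^ (-δ - 1)) u := fun u hu => by
      have := ((Real.hasDerivAt_rpow_const (p := -δ) (Or.inl hu.ne')).const_sub
        (s ^ (-δ))).const_mul (C / δ)
      refine this.congr_deriv ?_
      field_simp
    have hC0 : 0 ≤ C * s ^ (-δ - 1) := (norm_nonneg _).trans (hbound s hs)
    have hs0 : 0 < s := hl0.trans_le hs
    have hC0' : 0 ≤ C := nonneg_of_mul_nonneg_left hC0 (Real.rpow_pos_of_pos hs0 _)
    have := image_norm_le_of_norm_deriv_right_le_deriv_boundary' (f := fun u => f u - f s)
      (a := s) (b := t) ((hfc s t hs).sub continuousOn_const)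
      (fun u hu => (hfd u (hs0.trans_le hu.1)).sub_const _)
      (B := fun u : ℝ => C / δ * (s ^ (-δ) - u ^ (-δ))) (by simp)
      (fun u hu => (hB u (hs0.trans_le hu.1)).continuousAt.continuousWithinAt)
      (fun u hu => (hB u (hs0.trans_le hu.1)).hasDerivWithinAt)
      (fun u hu => hbound u (hs.trans hu.1)) (Set.right_mem_Icc.2 hst)
    refine this.trans ?_
    have : 0 ≤ t ^ (-δ) := (Real.rpow_pos_of_pos (hs0.trans_le hst) _).le
    have : 0 ≤ C / δ := by positivity
    gcongr
    linarith
  have hlim0 : Tendsto (fun s : ℝ => C / δ * s ^ (-δ)) atTop (nhds 0) := by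
    simpa using (tendsto_rpow_neg_atTop hδ0).const_mul (C / δ)
  have hcauchy : CauchySeq f := by
    refine Metric.cauchySeq_iff'.2 fun ε hε => ?_
    obtain ⟨N, hN⟩ := ((hlim0.eventually (gt_mem_nhds hε)).and (eventually_ge_atTop l)).exists
    refine ⟨N, fun t ht => ?_⟩
    rw [dist_eq_norm]
    exact (hdiff N t hN.2 ht).trans_lt hN.1
  obtain ⟨c', hc'⟩ := cauchySeq_tendsto_of_complete hcauchy
  have hlimit : ∀ s : ℝ, l ≤ s → ‖f s - c'‖ ≤ C / δ * s ^ (-δ) := fun s hs => by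
    rw [norm_sub_rev]
    exact le_of_tendsto (hc'.sub_const _).norm
      ((eventually_ge_atTop s).mono fun t ht => hdiff s t hs ht)
  refine ⟨(κ + 1) * c', ‖κ + 1‖ * (C / δ) + C, fun x hx => ?_⟩
  set t := Real.log x with ht
  have hlt : l ≤ t := Real.log_le_log (by norm_num) hx
  have ht0 : 0 < t := hl0.trans_le hlt
  have htc : (t : ℂ) ≠ 0 := by exact_mod_cast ht0.ne'
  have hxe : Real.exp t = x := Real.exp_log (by linarith)
  have h1 := hC x hx
  have h2 := hlimit t hlt
  simp only [hf, hxe] at h2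
  have key : ((∑ n ∈ Icc 1 ⌊x⌋₊, a n) - (κ + 1) * c' * (t : ℂ) ^ κ) * t =
      ((∑ n ∈ Icc 1 ⌊x⌋₊, a n) * (t : ℂ) - (κ + 1) * logWeightedSum a x) +
      (κ + 1) * ((logWeightedSum a x * (t : ℂ) ^ (-(κ + 1)) - c') * (t : ℂ) ^ (κ + 1)) := by
    have e1 : (t : ℂ) ^ (-(κ + 1)) * (t : ℂ) ^ (κ + 1) = 1 := by
      rw [← Complex.cpow_add _ _ htc, neg_add_cancel, Complex.cpow_zero]
    have e2 : (t : ℂ) ^ (κ + 1) = (t : ℂ) ^ κ * t := by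
      rw [Complex.cpow_add _ _ htc, Complex.cpow_one]
    rw [sub_mul _ c', mul_assoc (logWeightedSum a x), e1, e2]
    ring
  have h3 : ‖((∑ n ∈ Icc 1 ⌊x⌋₊, a n) - (κ + 1) * c' * (t : ℂ) ^ κ)‖ * t ≤
      (‖κ + 1‖ * (C / δ) + C) * t ^ β := by
    have : ‖((∑ n ∈ Icc 1 ⌊x⌋₊, a n) - (κ + 1) * c' * (t : ℂ) ^ κ)‖ * t =
        ‖((∑ n ∈ Icc 1 ⌊x⌋₊, a n) - (κ + 1) * c' * (t : ℂ) ^ κ) * t‖ := by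
      rw [norm_mul, Complex.norm_of_nonneg ht0.le]
    rw [this, key]
    refine (norm_add_le _ _).trans ?_
    rw [norm_mul, norm_mul _ ((t : ℂ) ^ (κ + 1)), Complex.norm_cpow_eq_rpow_re_of_pos ht0]
    have e3 : t ^ (-δ) * t ^ (κ + 1).re = t ^ β := by
      rw [← Real.rpow_add ht0]
      congr 1
      simp [hδ]
    calc _ ≤ C * t ^ β + ‖κ + 1‖ * ((C / δ * t ^ (-δ)) * t ^ (κ + 1).re) := by gcongr
      _ = _ := by rw [mul_assoc (C / δ), e3]; ring
  rw [Real.rpow_sub_one ht0.ne', mul_div_assoc', le_div_iff₀ ht0]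
  exact h3

lemma sum_filter_prime_le_tsum {f : ℕ → ℝ} (hf : ∀ p, 0 ≤ f p)
    (hs : Summable fun p : Nat.Primes => f p) (s : Finset ℕ) :
    ∑ p ∈ s.filter Nat.Prime, f p ≤ ∑' p : Nat.Primes, f p := by
  rw [← sum_subtype_eq_sum_filter]
  have h : HasSum (fun p : {p : ℕ // p.Prime} => f p) (∑' p : Nat.Primes, f p) := hs.hasSum
  exact sum_le_hasSum (s.subtype Nat.Prime) (fun p _ => hf p) h

lemma sum_factorization_mul_ordCompl_le (p : ℕ) {W : ℕ → ℝ} (hW : ∀ r, 0 ≤ W r)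
    (hWs : Summable W) {b : ℕ → ℝ} (hb : ∀ m, 0 ≤ b m) (X : ℕ) :
    ∑ n ∈ Icc 1 X, W (n.factorization p) * b (n / p ^ n.factorization p) ≤
      (∑' r, W r) * ∑ m ∈ Icc 1 X, b m := by
  set i : ℕ → ℕ × ℕ := fun n => (n.factorization p, n / p ^ n.factorization p) with hi
  have hinj : Set.InjOn i (Icc 1 X) := by
    intro m _ n _ h
    rw [hi, Prod.mk.injEq] at h
    rw [← Nat.ordProj_mul_ordCompl_eq_self m p, ← Nat.ordProj_mul_ordCompl_eq_self n p, h.2, h.1]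
  have hsub : (Icc 1 X).image i ⊆ range (X + 1) ×ˢ Icc 1 X := by
    intro q hq
    obtain ⟨n, hn, rfl⟩ := mem_image.1 hq
    rw [mem_Icc] at hn
    have hn0 : n ≠ 0 := by omega
    have h1 : n.factorization p < n := Nat.factorization_lt p hn0
    have h2 := Nat.ordCompl_pos p hn0
    have h3 : n / p ^ n.factorization p ≤ n := Nat.div_le_self _ _
    simp only [hi, mem_product, mem_range, mem_Icc]
    exact ⟨by omega, h2, by omega⟩
  calc ∑ n ∈ Icc 1 X, W (n.factorization p) * b (n / p ^ n.factorization p)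
      = ∑ q ∈ (Icc 1 X).image i, W q.1 * b q.2 := by rw [sum_image hinj]
    _ ≤ ∑ q ∈ range (X + 1) ×ˢ Icc 1 X, W q.1 * b q.2 :=
      sum_le_sum_of_subset_of_nonneg hsub fun q _ _ => mul_nonneg (hW _) (hb _)
    _ = (∑ r ∈ range (X + 1), W r) * ∑ m ∈ Icc 1 X, b m := by
      rw [sum_product, sum_mul_sum]
    _ ≤ _ := mul_le_mul_of_nonneg_right (hWs.sum_le_tsum _ fun r _ => hW r)
      (sum_nonneg fun m _ => hb m)

lemma sum_prime_sum_dvd_eq (h : ℕ → ℕ → ℂ) (X : ℕ) :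
    ∑ p ∈ (range (X + 1)).filter Nat.Prime, ∑ n ∈ Icc 1 X, (if p ∣ n then h p (n / p) else 0) =
      ∑ m ∈ Icc 1 X, ∑ p ∈ (range (X / m + 1)).filter Nat.Prime, h p m := by
  have h1 : ∀ p ∈ (range (X + 1)).filter Nat.Prime,
      ∑ n ∈ Icc 1 X, (if p ∣ n then h p (n / p) else 0) = ∑ m ∈ Icc 1 (X / p), h p m := by
    intro p hp
    have hp0 := (mem_filter.1 hp).2.pos
    rw [← sum_filter]
    refine sum_nbij' (fun n => n / p) (fun m => p * m) ?_ ?_ ?_ ?_ ?_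
    · intro n hn
      simp only [mem_filter, mem_Icc] at hn ⊢
      exact ⟨Nat.div_pos (Nat.le_of_dvd (by omega) hn.2) hp0, Nat.div_le_div_right hn.1.2⟩
    · intro m hm
      simp only [mem_filter, mem_Icc] at hm ⊢
      refine ⟨⟨Nat.mul_pos hp0 hm.1, ?_⟩, dvd_mul_right _ _⟩
      rw [mul_comm]
      exact (Nat.le_div_iff_mul_le hp0).1 hm.2
    · intro n hn
      exact Nat.mul_div_cancel' (mem_filter.1 hn).2
    · intro m _
      exact Nat.mul_div_cancel_left _ hp0
    · intro n _; rfl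
  rw [sum_congr rfl h1]
  refine sum_comm' fun p m => ?_
  simp only [mem_filter, mem_range, mem_Icc, Nat.lt_succ_iff]
  constructor
  · rintro ⟨⟨_, hp⟩, hm, hmX⟩
    have h2 := (Nat.le_div_iff_mul_le hp.pos).1 hmX
    refine ⟨⟨(Nat.le_div_iff_mul_le hm).2 (by rwa [mul_comm]), hp⟩, hm, ?_⟩
    exact hmX.trans (Nat.div_le_self _ _)
  · rintro ⟨⟨hpX, hp⟩, hm, _⟩
    have h2 := (Nat.le_div_iff_mul_le hm).1 hpX
    exact ⟨⟨hpX.trans (Nat.div_le_self _ _), hp⟩, hm,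
      (Nat.le_div_iff_mul_le hp.pos).2 (by rwa [mul_comm])⟩

/-- Weights controlling the contribution of the higher powers of `p`. -/
noncomputable def primePowWeight (a : ℕ → ℂ) (p : ℕ) : ℕ → ℝ
  | 0 => 0
  | 1 => 0
  | r + 2 => ‖a (p ^ (r + 2))‖ * Real.log ((p : ℝ) ^ (r + 2)) +
      ‖a p‖ * Real.log p * ‖a (p ^ (r + 1))‖

lemma primePowWeight_nonneg (a : ℕ → ℂ) (p r : ℕ) : 0 ≤ primePowWeight a p r := by
  have h : 0 ≤ Real.log p := Real.log_natCast_nonneg p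
  match r with
  | 0 => exact le_rfl
  | 1 => exact le_rfl
  | r + 2 =>
    rw [primePowWeight, Real.log_pow]
    positivity

lemma norm_log_mul_factorization_sub_le {a : ℕ → ℂ} (ha1 : a 1 = 1)
    (hmul : ∀ m n : ℕ, Nat.Coprime m n → a (m * n) = a m * a n) {p : ℕ} (hp : p.Prime)
    {n : ℕ} (hn : n ≠ 0) :
    ‖a n * ((n.factorization p : ℂ) * (Real.log p : ℂ)) -
        (if p ∣ n then a p * (Real.log p : ℂ) * a (n / p) else 0)‖ ≤
      primePowWeight a p (n.factorization p) * ‖a (n / p ^ n.factorization p)‖ := by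
  set r := n.factorization p with hr
  set m := n / p ^ r with hm
  have hnm : n = p ^ r * m := (Nat.ordProj_mul_ordCompl_eq_self n p).symm
  have hpm : Nat.Coprime p m := Nat.coprime_ordCompl hp hn
  have han : a n = a (p ^ r) * a m := by
    conv_lhs => rw [hnm]
    exact hmul _ _ (hpm.pow_left r)
  have hlog : 0 ≤ Real.log p := Real.log_natCast_nonneg p
  by_cases hpn : p ∣ n
  · have hr0 : r ≠ 0 := (hp.factorization_pos_of_dvd hn hpn).ne'
    obtain ⟨s, hs⟩ := Nat.exists_eq_succ_of_ne_zero hr0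
    have hdiv : n / p = p ^ s * m := by
      conv_lhs => rw [hnm, hs, Nat.succ_eq_add_one, pow_succ, mul_comm (p ^ s), mul_assoc]
      exact Nat.mul_div_cancel_left _ hp.pos
    rw [if_pos hpn, hdiv, hmul _ _ (hpm.pow_left s), han, hs]
    match s with
    | 0 => simp [ha1, primePowWeight]; ring_nf
    | s + 1 =>
      simp only [Nat.succ_eq_add_one, primePowWeight, add_mul]
      refine (norm_sub_le _ _).trans (le_of_eq ?_)
      simp only [norm_mul, Complex.norm_natCast, Complex.norm_real, Real.norm_of_nonneg hlog,
        Real.log_pow]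
      ring
  · have hr0 : r = 0 := Nat.factorization_eq_zero_of_not_dvd hpn
    rw [if_neg hpn, hr0]
    simp [primePowWeight]

/-- The convolution identity `a · log = a * (a Λ)` up to prime powers, summed over `n ≤ X`. -/
theorem exists_norm_sum_mul_log_sub_le {a : ℕ → ℂ} (ha1 : a 1 = 1)
    (hmul : ∀ m n : ℕ, Nat.Coprime m n → a (m * n) = a m * a n)
    (hinner1 : ∀ p : Nat.Primes, Summable fun r : ℕ => ‖a ((p : ℕ) ^ (r + 1))‖)
    (hsum1 : Summable fun p : Nat.Primes =>
      ‖a (p : ℕ)‖ * Real.log (p : ℕ) * ∑' r : ℕ, ‖a ((p : ℕ) ^ (r + 1))‖)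
    (hinner2 : ∀ p : Nat.Primes, Summable fun r : ℕ =>
      ‖a ((p : ℕ) ^ (r + 2))‖ * Real.log (((p : ℕ) : ℝ) ^ (r + 2)))
    (hsum2 : Summable fun p : Nat.Primes =>
      ∑' r : ℕ, ‖a ((p : ℕ) ^ (r + 2))‖ * Real.log (((p : ℕ) : ℝ) ^ (r + 2))) :
    ∃ D : ℝ, ∀ X : ℕ, ‖∑ n ∈ Icc 1 X, a n * (Real.log n : ℂ) -
      ∑ m ∈ Icc 1 X, a m * ∑ p ∈ (range (X / m + 1)).filter Nat.Prime, a p * (Real.log p : ℂ)‖ ≤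
        D * ∑ m ∈ Icc 1 X, ‖a m‖ := by
  have hWs2 : ∀ p : Nat.Primes, Summable fun r => primePowWeight a p (r + 2) := fun p =>
    (hinner2 p).add ((hinner1 p).mul_left _)
  have hWs : ∀ p : Nat.Primes, Summable (primePowWeight a p) := fun p =>
    (summable_nat_add_iff 2).1 (hWs2 p)
  have hWt : ∀ p : Nat.Primes, ∑' r, primePowWeight a p r =
      ∑' r : ℕ, ‖a ((p : ℕ) ^ (r + 2))‖ * Real.log (((p : ℕ) : ℝ) ^ (r + 2)) +
      ‖a (p : ℕ)‖ * Real.log (p : ℕ) * ∑' r : ℕ, ‖a ((p : ℕ) ^ (r + 1))‖ := fun p => by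
    rw [← (hWs p).sum_add_tsum_nat_add 2, ← tsum_mul_left,
      ← (hinner2 p).tsum_add ((hinner1 p).mul_left _)]
    simp [sum_range_succ, primePowWeight]
  have hWsum : Summable fun p : Nat.Primes => ∑' r, primePowWeight a p r := by
    simp_rw [hWt]
    exact hsum2.add hsum1
  have hWnn : ∀ p : ℕ, 0 ≤ ∑' r, primePowWeight a p r := fun p =>
    tsum_nonneg fun r => primePowWeight_nonneg a p r
  refine ⟨∑' p : Nat.Primes, ∑' r, primePowWeight a p r, fun X => ?_⟩
  have e1 : ∑ n ∈ Icc 1 X, a n * (Real.log n : ℂ) =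
      ∑ p ∈ (range (X + 1)).filter Nat.Prime, ∑ n ∈ Icc 1 X,
        a n * ((n.factorization p : ℂ) * (Real.log p : ℂ)) := by
    rw [sum_comm]
    refine sum_congr rfl fun n hn => ?_
    rw [← mul_sum, Real.log_nat_eq_sum_factorization, Finsupp.sum]
    push_cast
    congr 1
    refine sum_subset ?_ ?_
    · intro p hp
      rw [Nat.support_factorization] at hp
      have := Nat.le_of_mem_primeFactors hp
      rw [mem_Icc] at hn
      exact mem_filter.2 ⟨mem_range.2 (by omega), Nat.prime_of_mem_primeFactors hp⟩
    · intro p _ hp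
      rw [Finsupp.notMem_support_iff.1 hp]
      simp
  have e2 : ∑ m ∈ Icc 1 X, a m *
      ∑ p ∈ (range (X / m + 1)).filter Nat.Prime, a p * (Real.log p : ℂ) =
      ∑ p ∈ (range (X + 1)).filter Nat.Prime, ∑ n ∈ Icc 1 X,
        (if p ∣ n then a p * (Real.log p : ℂ) * a (n / p) else 0) := by
    rw [sum_prime_sum_dvd_eq (fun p m => a p * (Real.log p : ℂ) * a m)]
    refine sum_congr rfl fun m _ => ?_
    rw [mul_comm, sum_mul]
  rw [e1, e2, ← sum_sub_distrib]
  have hB : 0 ≤ ∑ m ∈ Icc 1 X, ‖a m‖ := sum_nonneg fun m _ => norm_nonneg _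
  calc _ ≤ ∑ p ∈ (range (X + 1)).filter Nat.Prime,
        (∑' r, primePowWeight a p r) * ∑ m ∈ Icc 1 X, ‖a m‖ := by
        refine norm_sum_le_of_le _ fun p hp => ?_
        have hpp := (mem_filter.1 hp).2
        rw [← sum_sub_distrib]
        refine (norm_sum_le_of_le _ fun n hn => norm_log_mul_factorization_sub_le ha1 hmul hpp
          (by rw [mem_Icc] at hn; omega)).trans ?_
        exact sum_factorization_mul_ordCompl_le p (primePowWeight_nonneg a p) (hWs ⟨p, hpp⟩)
          (fun m => norm_nonneg (a m)) X
    _ = (∑ p ∈ (range (X + 1)).filter Nat.Prime, ∑' r, primePowWeight a p r) *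
        ∑ m ∈ Icc 1 X, ‖a m‖ := by rw [sum_mul]
    _ ≤ _ := by
        refine mul_le_mul_of_nonneg_right ?_ hB
        exact sum_filter_prime_le_tsum hWnn hWsum _

lemma sum_norm_le_prod_tsum {a : ℕ → ℂ} (ha1 : a 1 = 1)
    (hmul : ∀ m n : ℕ, Nat.Coprime m n → a (m * n) = a m * a n)
    (hs : ∀ {p : ℕ}, p.Prime → Summable fun r : ℕ => ‖‖a (p ^ r)‖‖) (X : ℕ) :
    ∑ m ∈ Icc 1 X, ‖a m‖ ≤
      ∏ p ∈ (range (X + 1)).filter Nat.Prime, ∑' r : ℕ, ‖a (p ^ r)‖ := by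
  classical
  obtain ⟨-, hH⟩ := EulerProduct.summable_and_hasSum_smoothNumbers_prod_primesBelow_tsum
    (f := fun n => ‖a n‖) (by simp [ha1])
    (fun {m n} h => by rw [hmul m n h, norm_mul]) hs (X + 1)
  have hfil : (Icc 1 X).filter (· ∈ (X + 1).smoothNumbers) = Icc 1 X := by
    refine filter_true_of_mem fun m hm => ?_
    rw [mem_Icc] at hm
    exact Nat.mem_smoothNumbers_of_lt (by omega) (by omega)
  have := sum_le_hasSum ((Icc 1 X).subtype (· ∈ (X + 1).smoothNumbers))
    (fun m _ => norm_nonneg (a m)) hH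
  have h := sum_subtype_eq_sum_filter (fun m => ‖a m‖) (p := (· ∈ (X + 1).smoothNumbers))
    (s := Icc 1 X)
  rw [hfil] at h
  exact h.symm.trans_le this

/-- The absolute partial sums of a multiplicative function are bounded by its Euler product. -/
theorem exists_sum_norm_le_prod {a : ℕ → ℂ} (ha1 : a 1 = 1)
    (hmul : ∀ m n : ℕ, Nat.Coprime m n → a (m * n) = a m * a n)
    (hinner2 : ∀ p : Nat.Primes, Summable fun r : ℕ =>
      ‖a ((p : ℕ) ^ (r + 2))‖)
    (hsum2 : Summable fun p : Nat.Primes => ∑' r : ℕ, ‖a ((p : ℕ) ^ (r + 2))‖) :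
    ∃ D : ℝ, 0 ≤ D ∧ ∀ X : ℕ, ∑ m ∈ Icc 1 X, ‖a m‖ ≤
      D * ∏ p ∈ (range (X + 1)).filter Nat.Prime, (1 + ‖a p‖) := by
  set e : ℕ → ℝ := fun p => ∑' r : ℕ, ‖a (p ^ (r + 2))‖ with he
  have he0 : ∀ p, 0 ≤ e p := fun p => tsum_nonneg fun r => norm_nonneg _
  refine ⟨Real.exp (∑' p : Nat.Primes, e p), (Real.exp_pos _).le, fun X => ?_⟩
  have hs : ∀ {p : ℕ}, p.Prime → Summable fun r : ℕ => ‖‖a (p ^ r)‖‖ := fun {p} hp => by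
    simp_rw [norm_norm]
    have h := hinner2 ⟨p, hp⟩
    exact (summable_nat_add_iff (f := fun r : ℕ => ‖a (p ^ r)‖) 2).1 h
  have h1 : ∑ m ∈ Icc 1 X, ‖a m‖ ≤
      ∏ p ∈ (range (X + 1)).filter Nat.Prime, ∑' r : ℕ, ‖a (p ^ r)‖ :=
    sum_norm_le_prod_tsum ha1 hmul hs X
  refine h1.trans ?_
  calc _ ≤ ∏ p ∈ (range (X + 1)).filter Nat.Prime, Real.exp (e p) * (1 + ‖a p‖) := by
        refine prod_le_prod (fun p _ => tsum_nonneg fun r => norm_nonneg _) fun p hp => ?_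
        have hpp := (mem_filter.1 hp).2
        have := (hs hpp)
        simp only [norm_norm] at this
        rw [← this.sum_add_tsum_nat_add 2]
        simp only [sum_range_succ, range_zero, sum_empty, pow_zero, pow_one, ha1, norm_one,
          zero_add]
        have h2 := Real.add_one_le_exp (e p)
        have h3 : 1 ≤ Real.exp (e p) := by linarith [he0 p]
        nlinarith [norm_nonneg (a p), he0 p]
    _ = Real.exp (∑ p ∈ (range (X + 1)).filter Nat.Prime, e p) *
        ∏ p ∈ (range (X + 1)).filter Nat.Prime, (1 + ‖a p‖) := by
        rw [prod_mul_distrib, Real.exp_sum]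
    _ ≤ _ := by
        gcongr
        exact sum_filter_prime_le_tsum he0 hsum2 _

theorem exists_norm_sum_mul_log_sub_logWeightedSum_le {a : ℕ → ℂ} (ha1 : a 1 = 1)
    (hmul : ∀ m n : ℕ, Nat.Coprime m n → a (m * n) = a m * a n) {κ : ℂ}
    (hmertens : ∃ C : ℝ, ∀ w : ℝ, 2 ≤ w →
      ‖∑ p ∈ (range (⌊w⌋₊ + 1)).filter Nat.Prime, a p * (Real.log p : ℂ) -
        κ * (Real.log w : ℂ)‖ ≤ C)
    (hinner1 : ∀ p : Nat.Primes, Summable fun r : ℕ => ‖a ((p : ℕ) ^ (r + 1))‖)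
    (hsum1 : Summable fun p : Nat.Primes =>
      ‖a (p : ℕ)‖ * Real.log (p : ℕ) * ∑' r : ℕ, ‖a ((p : ℕ) ^ (r + 1))‖)
    (hinner2 : ∀ p : Nat.Primes, Summable fun r : ℕ =>
      ‖a ((p : ℕ) ^ (r + 2))‖ * Real.log (((p : ℕ) : ℝ) ^ (r + 2)))
    (hsum2 : Summable fun p : Nat.Primes =>
      ∑' r : ℕ, ‖a ((p : ℕ) ^ (r + 2))‖ * Real.log (((p : ℕ) : ℝ) ^ (r + 2))) :
    ∃ D : ℝ, ∀ x : ℝ, 2 ≤ x → ‖(∑ n ∈ Icc 1 ⌊x⌋₊, a n) * (Real.log x : ℂ) -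
      (κ + 1) * logWeightedSum a x‖ ≤ D * ∑ m ∈ Icc 1 ⌊x⌋₊, ‖a m‖ := by
  obtain ⟨C, hC⟩ := hmertens
  obtain ⟨D, hD⟩ := exists_norm_sum_mul_log_sub_le ha1 hmul hinner1 hsum1 hinner2 hsum2
  have hC' : ∀ w : ℝ, 1 ≤ w →
      ‖∑ p ∈ (range (⌊w⌋₊ + 1)).filter Nat.Prime, a p * (Real.log p : ℂ) -
        κ * (Real.log w : ℂ)‖ ≤ max C ‖κ‖ := by
    intro w hw
    rcases le_or_gt 2 w with h | h
    · exact (hC w h).trans (le_max_left _ _)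
    · refine le_trans ?_ (le_max_right _ _)
      have hfl : ⌊w⌋₊ < 2 := (Nat.floor_lt (by linarith)).2 (by exact_mod_cast h)
      rw [sum_eq_zero, zero_sub, norm_neg, norm_mul, Complex.norm_real,
        Real.norm_of_nonneg (Real.log_nonneg hw)]
      · have h1 : Real.log w ≤ 1 := by linarith [Real.log_le_sub_one_of_pos (by linarith : 0 < w)]
        exact mul_le_of_le_one_right (norm_nonneg _) h1
      · intro p hp
        rw [mem_filter, mem_range] at hp
        have := hp.2.two_le
        omega
  refine ⟨D + max C ‖κ‖, fun x hx => ?_⟩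
  set X := ⌊x⌋₊ with hX
  have key : (∑ n ∈ Icc 1 X, a n) * (Real.log x : ℂ) - (κ + 1) * logWeightedSum a x =
      (∑ n ∈ Icc 1 X, a n * (Real.log n : ℂ) -
        ∑ m ∈ Icc 1 X, a m * ∑ p ∈ (range (X / m + 1)).filter Nat.Prime,
          a p * (Real.log p : ℂ)) +
      ∑ m ∈ Icc 1 X, a m * (∑ p ∈ (range (X / m + 1)).filter Nat.Prime,
          a p * (Real.log p : ℂ) - κ * ((Real.log x - Real.log m : ℝ) : ℂ)) := by
    simp only [logWeightedSum, ← hX, mul_sum, sum_mul, ← sum_sub_distrib, ← sum_add_distrib]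
    refine sum_congr rfl fun m _ => ?_
    rw [← mul_sum]
    push_cast
    ring
  rw [key, add_mul]
  refine (norm_add_le _ _).trans (add_le_add (hD X) ?_)
  rw [mul_sum]
  refine norm_sum_le_of_le _ fun m hm => ?_
  rw [mem_Icc] at hm
  have hm0 : (0 : ℝ) < m := by exact_mod_cast hm.1
  have hmx : (m : ℝ) ≤ x := (Nat.le_floor_iff (by linarith)).1 hm.2
  have h := hC' (x / m) ((one_le_div hm0).2 hmx)
  rw [Nat.floor_div_natCast, Real.log_div (by linarith) hm0.ne'] at h
  rw [norm_mul, mul_comm]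
  gcongr

lemma LSeries_eq_integral_exp {a : ℕ → ℂ} {β D : ℝ}
    (hD : ∀ x : ℝ, 2 ≤ x → ∑ m ∈ Icc 1 ⌊x⌋₊, ‖a m‖ ≤ D * Real.log x ^ β) {s : ℝ} (hs : 0 < s) :
    LSeriesSummable a s ∧ LSeries a s =
      ∫ v in Set.Ioi (0 : ℝ), (Real.exp (-v) : ℂ) * ∑ n ∈ Icc 1 ⌊Real.exp (v / s)⌋₊, a n := by
  have hO : (fun n : ℕ => ∑ k ∈ Icc 1 n, ‖a k‖) =O[atTop] fun n : ℕ => (n : ℝ) ^ (s / 2) := by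
    have h1 : (fun n : ℕ => ∑ k ∈ Icc 1 n, ‖a k‖) =O[atTop]
        fun n : ℕ => Real.log (n : ℝ) ^ β := by
      refine Asymptotics.IsBigO.of_bound D ?_
      filter_upwards [eventually_ge_atTop 2] with n hn
      have h := hD n (by exact_mod_cast hn)
      rw [Nat.floor_natCast] at h
      rw [Real.norm_of_nonneg (sum_nonneg fun _ _ => norm_nonneg _),
        Real.norm_of_nonneg (Real.rpow_nonneg (Real.log_natCast_nonneg n) _)]
      exact h
    exact h1.trans ((isLittleO_log_rpow_rpow_atTop β (half_pos hs)).comp_tendsto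
      tendsto_natCast_atTop_atTop).isBigO
  have hr : s / 2 < (s : ℂ).re := by rw [Complex.ofReal_re]; linarith
  refine ⟨LSeriesSummable_of_sum_norm_bigO hO (half_pos hs).le hr, ?_⟩
  rw [LSeries_eq_mul_integral' a (half_pos hs).le hr hO]
  have h1 := MeasureTheory.integral_comp_exp_Ioi
    (fun t : ℝ => (∑ k ∈ Icc 1 ⌊t⌋₊, a k) * (t : ℂ) ^ (-((s : ℂ) + 1))) 0
  rw [Real.exp_zero] at h1
  rw [← h1]
  have h2 := MeasureTheory.integral_comp_mul_left_Ioi (fun v : ℝ => (Real.exp (-v) : ℂ) *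
    ∑ n ∈ Icc 1 ⌊Real.exp (v / s)⌋₊, a n) 0 hs
  rw [mul_zero] at h2
  have hsc : (s : ℂ) ≠ 0 := by exact_mod_cast hs.ne'
  have h3 : ∀ I J : ℂ, I = s⁻¹ • J → (s : ℂ) * I = J := fun I J h => by
    rw [h, Complex.real_smul, Complex.ofReal_inv, mul_inv_cancel_left₀ hsc]
  refine h3 _ _ ?_
  rw [← h2]
  refine MeasureTheory.setIntegral_congr_fun measurableSet_Ioi fun u _ => ?_
  have h4 : (Real.exp u : ℂ) ^ (-((s : ℂ) + 1)) * (Real.exp u : ℂ) = (Real.exp (-(s * u)) : ℂ) := by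
    have he : (Real.exp u : ℂ) ≠ 0 := by exact_mod_cast (Real.exp_pos u).ne'
    rw [Complex.cpow_def_of_ne_zero he, ← Complex.ofReal_log (Real.exp_pos u).le, Real.log_exp,
      Complex.ofReal_exp, Complex.ofReal_exp, ← Complex.exp_add]
    congr 1
    push_cast
    ring
  rw [mul_div_cancel_left₀ _ hs.ne', Complex.real_smul, ← h4]
  ring

lemma tendsto_cpow_mul_LSeries {a : ℕ → ℂ} (ha1 : a 1 = 1) {β D K : ℝ} {κ c : ℂ}
    (hβ0 : 0 ≤ β) (hβ : β < κ.re + 1)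
    (hD : ∀ x : ℝ, 2 ≤ x → ∑ m ∈ Icc 1 ⌊x⌋₊, ‖a m‖ ≤ D * Real.log x ^ β)
    (hM : ∀ x : ℝ, 2 ≤ x →
      ‖(∑ n ∈ Icc 1 ⌊x⌋₊, a n) - c * (Real.log x : ℂ) ^ κ‖ ≤ K * Real.log x ^ (β - 1)) :
    Tendsto (fun s : ℝ => (s : ℂ) ^ κ * LSeries a s) (nhdsWithin 0 (Set.Ioi 0))
      (nhds (Complex.Gamma (κ + 1) * c)) := by
  set M : ℝ → ℂ := fun x => ∑ n ∈ Icc 1 ⌊x⌋₊, a n with hMdef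
  have hMmeas : Measurable M :=
    (measurable_from_nat (f := fun N : ℕ => ∑ n ∈ Icc 1 N, a n)).comp Nat.measurable_floor
  have hl2 : 0 < Real.log 2 := Real.log_pos one_lt_two
  have hMexp : ∀ u : ℝ, Real.log 2 ≤ u →
      ‖M (Real.exp u) - c * (u : ℂ) ^ κ‖ ≤ |K| * u ^ (β - 1) := fun u hu => by
    have h := hM (Real.exp u) (by rwa [← Real.log_le_iff_le_exp two_pos])
    rw [Real.log_exp] at h
    exact h.trans (mul_le_mul_of_nonneg_right (le_abs_self K)
      (Real.rpow_nonneg (hl2.le.trans hu) _))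
  have hscale : ∀ s v : ℝ, 0 < s → 0 < v → (s : ℂ) ^ κ * ((v / s : ℝ) : ℂ) ^ κ = (v : ℂ) ^ κ :=
    fun s v hs hv => by
      rw [← Complex.mul_cpow_ofReal_nonneg hs.le (div_pos hv hs).le, ← Complex.ofReal_mul,
        mul_div_cancel₀ _ hs.ne']
  have herr : ∀ s v : ℝ, 0 < s → 0 < v →
      s ^ κ.re * (v / s) ^ (β - 1) = v ^ (β - 1) * s ^ (κ.re + 1 - β) := fun s v hs hv => by
    rw [Real.div_rpow hv.le hs.le, show κ.re + 1 - β = κ.re - (β - 1) by ring,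
      Real.rpow_sub hs κ.re (β - 1)]
    ring
  have hpt : ∀ s v : ℝ, 0 < s → 0 < v → Real.log 2 ≤ v / s →
      ‖(s : ℂ) ^ κ * M (Real.exp (v / s)) - c * (v : ℂ) ^ κ‖ ≤
        |K| * (v ^ (β - 1) * s ^ (κ.re + 1 - β)) := fun s v hs hv h => by
    have h1 : (s : ℂ) ^ κ * M (Real.exp (v / s)) - c * (v : ℂ) ^ κ =
        (s : ℂ) ^ κ * (M (Real.exp (v / s)) - c * ((v / s : ℝ) : ℂ) ^ κ) := by
      rw [← hscale s v hs hv]; ring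
    rw [h1, norm_mul, Complex.norm_cpow_eq_rpow_re_of_pos hs, ← herr s v hs hv]
    calc _ ≤ s ^ κ.re * (|K| * (v / s) ^ (β - 1)) :=
          mul_le_mul_of_nonneg_left (hMexp _ h) (Real.rpow_nonneg hs.le _)
      _ = _ := by ring
  have hΓ : Complex.Gamma (κ + 1) * c =
      ∫ v in Set.Ioi (0 : ℝ), (Real.exp (-v) : ℂ) * (c * (v : ℂ) ^ κ) := by
    rw [Complex.Gamma_eq_integral (by rw [Complex.add_re, Complex.one_re]; linarith),
      Complex.GammaIntegral, ← MeasureTheory.integral_mul_const]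
    refine MeasureTheory.integral_congr_ae (Eventually.of_forall fun v => ?_)
    simp only [add_sub_cancel_right]
    ring
  have hmain : Tendsto (fun s : ℝ => ∫ v in Set.Ioi (0 : ℝ),
      (Real.exp (-v) : ℂ) * ((s : ℂ) ^ κ * M (Real.exp (v / s)))) (nhdsWithin 0 (Set.Ioi 0))
      (nhds (∫ v in Set.Ioi (0 : ℝ), (Real.exp (-v) : ℂ) * (c * (v : ℂ) ^ κ))) := by
    set A : ℝ := ‖c‖ + |K| * Real.log 2 ^ (β - 1 - κ.re) + 1 with hA
    refine MeasureTheory.tendsto_integral_filter_of_dominated_convergence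
      (fun v => A * (Real.exp (-v) * v ^ (κ.re + 1 - 1)) +
        Real.exp (-v) * v ^ ((1 : ℝ) - 1)) ?_ ?_ ?_ ?_
    · refine Eventually.of_forall fun s => Measurable.aestronglyMeasurable ?_
      exact (by fun_prop : Measurable fun v : ℝ => (Real.exp (-v) : ℂ)).mul
        ((hMmeas.comp (by fun_prop : Measurable fun v : ℝ => Real.exp (v / s))).const_mul _)
    · have hs1 : ∀ᶠ s : ℝ in nhdsWithin 0 (Set.Ioi 0), s < 1 :=
        mem_nhdsWithin_of_mem_nhds (Iio_mem_nhds one_pos)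
      filter_upwards [hs1, self_mem_nhdsWithin] with s hs1 (hs : 0 < s)
      refine (MeasureTheory.ae_restrict_iff' measurableSet_Ioi).2
        (Eventually.of_forall fun v (hv : 0 < v) => ?_)
      have hvξ : 0 < v ^ κ.re := Real.rpow_pos_of_pos hv _
      have hkey : ‖(s : ℂ) ^ κ * M (Real.exp (v / s))‖ ≤ A * v ^ κ.re + 1 := by
        have hKn : 0 ≤ |K| * Real.log 2 ^ (β - 1 - κ.re) := by positivity
        rcases le_or_gt (Real.log 2) (v / s) with h | h
        · have h1 := hpt s v hs hv h
          have h2 : v ^ (β - 1) * s ^ (κ.re + 1 - β) ≤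
              Real.log 2 ^ (β - 1 - κ.re) * v ^ κ.re := by
            have h3 : v ^ (β - 1) * s ^ (κ.re + 1 - β) = (v / s) ^ (β - 1 - κ.re) * v ^ κ.re := by
              rw [← herr s v hs hv, show β - 1 = (β - 1 - κ.re) + κ.re by ring,
                Real.rpow_add (div_pos hv hs), Real.div_rpow hv.le hs.le (z := κ.re)]
              rw [show β - 1 - κ.re + κ.re - κ.re = β - 1 - κ.re by ring]
              field_simp
            rw [h3]
            exact mul_le_mul_of_nonneg_right
              (Real.rpow_le_rpow_of_nonpos hl2 h (by linarith)) hvξ.le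
          have h4 : ‖c * (v : ℂ) ^ κ‖ = ‖c‖ * v ^ κ.re := by
            rw [norm_mul, Complex.norm_cpow_eq_rpow_re_of_pos hv]
          have h5 := norm_le_norm_add_norm_sub' ((s : ℂ) ^ κ * M (Real.exp (v / s)))
            (c * (v : ℂ) ^ κ)
          have h6 := mul_le_mul_of_nonneg_left h2 (abs_nonneg K)
          rw [hA]
          nlinarith
        · have h1 : M (Real.exp (v / s)) = 1 := by
            have hf : ⌊Real.exp (v / s)⌋₊ = 1 := by
              rw [Nat.floor_eq_iff (Real.exp_pos _).le]
              refine ⟨?_, ?_⟩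
              · rw [Nat.cast_one]; exact Real.one_le_exp (div_pos hv hs).le
              · rw [Nat.cast_one, one_add_one_eq_two, ← Real.lt_log_iff_exp_lt two_pos]; exact h
            simp [hMdef, hf, ha1]
          rw [h1, mul_one, Complex.norm_cpow_eq_rpow_re_of_pos hs]
          have hvs : v ≤ s := by
            rw [div_lt_iff₀ hs] at h
            have := Real.log_two_lt_d9
            nlinarith
          have hA1 : v ^ κ.re ≤ A * v ^ κ.re :=
            le_mul_of_one_le_left hvξ.le (by rw [hA]; linarith [norm_nonneg c])
          rcases le_or_gt 0 κ.re with h0 | h0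
          · linarith [Real.rpow_le_one hs.le hs1.le h0]
          · linarith [Real.rpow_le_rpow_of_nonpos hv hvs h0.le]
      rw [norm_mul, Complex.norm_real, Real.norm_of_nonneg (Real.exp_pos _).le,
        add_sub_cancel_right, sub_self, Real.rpow_zero]
      calc _ ≤ Real.exp (-v) * (A * v ^ κ.re + 1) :=
            mul_le_mul_of_nonneg_left hkey (Real.exp_pos _).le
        _ = _ := by ring
    · exact ((Real.GammaIntegral_convergent (by linarith : 0 < κ.re + 1)).const_mul A).add
        (Real.GammaIntegral_convergent one_pos)
    · refine (MeasureTheory.ae_restrict_iff' measurableSet_Ioi).2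
        (Eventually.of_forall fun v (hv : 0 < v) => ?_)
      refine Tendsto.const_mul _ ?_
      rw [tendsto_iff_norm_sub_tendsto_zero]
      have hlim : Tendsto (fun s : ℝ => |K| * (v ^ (β - 1) * s ^ (κ.re + 1 - β)))
          (nhdsWithin 0 (Set.Ioi 0)) (nhds 0) := by
        have hp : 0 < κ.re + 1 - β := by linarith
        have h1 : Tendsto (fun s : ℝ => s ^ (κ.re + 1 - β)) (nhdsWithin 0 (Set.Ioi 0)) (nhds 0) := by
          have := (Real.continuousAt_rpow_const 0 _ (Or.inr hp.le)).tendsto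
          rw [Real.zero_rpow hp.ne'] at this
          exact this.mono_left nhdsWithin_le_nhds
        simpa using (h1.const_mul (v ^ (β - 1))).const_mul |K|
      have hbig : Tendsto (fun s : ℝ => v / s) (nhdsWithin 0 (Set.Ioi 0)) atTop := by
        simpa only [div_eq_mul_inv] using tendsto_inv_nhdsGT_zero.const_mul_atTop hv
      refine squeeze_zero' (Eventually.of_forall fun _ => norm_nonneg _) ?_ hlim
      filter_upwards [hbig.eventually_ge_atTop (Real.log 2), self_mem_nhdsWithin] with s h hs
      exact hpt s v hs hv h
  rw [hΓ]
  refine hmain.congr' ?_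
  filter_upwards [self_mem_nhdsWithin] with s (hs : 0 < s)
  rw [(LSeries_eq_integral_exp hD hs).2, ← MeasureTheory.integral_const_mul]
  refine MeasureTheory.integral_congr_ae (Eventually.of_forall fun v => ?_)
  simp only [hMdef]
  ring

lemma norm_sum_Ico_smul_le_of_antitone {f : ℕ → ℝ} {z : ℕ → ℂ} {K : ℝ} {m : ℕ}
    (hf : ∀ i, m ≤ i → f (i + 1) ≤ f i) (hf0 : ∀ i, m ≤ i → 0 ≤ f i)
    (hK : ∀ n, ‖∑ i ∈ range n, z i‖ ≤ K) {n : ℕ} (hmn : m ≤ n) :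
    ‖∑ i ∈ Ico m n, (f i : ℂ) * z i‖ ≤ 2 * K * f m := by
  set Z : ℕ → ℂ := fun n => ∑ i ∈ range n, z i with hZ
  have hZZ : ∀ i j, ‖Z i - Z j‖ ≤ 2 * K := fun i j => by
    linarith [norm_sub_le (Z i) (Z j), hK i, hK j]
  have key : ‖∑ i ∈ Ico m n, (f i : ℂ) * z i - (f n : ℂ) * (Z n - Z m)‖ ≤
      2 * K * (f m - f n) := by
    induction n, hmn using Nat.le_induction with
    | base => simp
    | succ n hmn ih =>
      have h1 : ∑ i ∈ Ico m (n + 1), (f i : ℂ) * z i - (f (n + 1) : ℂ) * (Z (n + 1) - Z m) =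
          (∑ i ∈ Ico m n, (f i : ℂ) * z i - (f n : ℂ) * (Z n - Z m)) +
            ((f n - f (n + 1) : ℝ) : ℂ) * (Z (n + 1) - Z m) := by
        rw [sum_Ico_succ_top hmn]
        simp only [hZ, sum_range_succ]
        push_cast
        ring
      rw [h1]
      have h2 : ‖((f n - f (n + 1) : ℝ) : ℂ) * (Z (n + 1) - Z m)‖ ≤
          (f n - f (n + 1)) * (2 * K) := by
        rw [norm_mul, Complex.norm_real, Real.norm_of_nonneg (by linarith [hf n hmn])]
        exact mul_le_mul_of_nonneg_left (hZZ _ _) (by linarith [hf n hmn])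
      linarith [norm_add_le (∑ i ∈ Ico m n, (f i : ℂ) * z i - (f n : ℂ) * (Z n - Z m))
        (((f n - f (n + 1) : ℝ) : ℂ) * (Z (n + 1) - Z m))]
  have h3 : ‖(f n : ℂ) * (Z n - Z m)‖ ≤ f n * (2 * K) := by
    rw [norm_mul, Complex.norm_real, Real.norm_of_nonneg (hf0 n hmn)]
    exact mul_le_mul_of_nonneg_left (hZZ _ _) (hf0 n hmn)
  linarith [norm_le_norm_add_norm_sub' (∑ i ∈ Ico m n, (f i : ℂ) * z i)
    ((f n : ℂ) * (Z n - Z m))]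

/-- The sequence `φ` converges pointwise on `[0, ∞)`, to a function that is right-continuous
at `0`. -/
def TendstoRightContinuous (φ : ℕ → ℝ → ℂ) : Prop :=
  ∃ Φ : ℝ → ℂ, (∀ s, 0 ≤ s → Tendsto (fun N => φ N s) atTop (nhds (Φ s))) ∧
    Tendsto Φ (nhdsWithin 0 (Set.Ioi 0)) (nhds (Φ 0))

lemma TendstoRightContinuous.mul {φ ψ : ℕ → ℝ → ℂ} (hφ : TendstoRightContinuous φ)
    (hψ : TendstoRightContinuous ψ) : TendstoRightContinuous fun N s => φ N s * ψ N s := by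
  obtain ⟨Φ, h1, h2⟩ := hφ
  obtain ⟨Ψ, h3, h4⟩ := hψ
  exact ⟨fun s => Φ s * Ψ s, fun s hs => (h1 s hs).mul (h3 s hs), h2.mul h4⟩

lemma TendstoRightContinuous.cexp {φ : ℕ → ℝ → ℂ} (hφ : TendstoRightContinuous φ) :
    TendstoRightContinuous fun N s => Complex.exp (φ N s) := by
  obtain ⟨Φ, h1, h2⟩ := hφ
  exact ⟨fun s => Complex.exp (Φ s), fun s hs => (h1 s hs).cexp, h2.cexp⟩

lemma tendstoRightContinuous_prod_one_add {v : ℕ → ℝ → ℂ} {b : ℕ → ℝ}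
    (hb : Summable fun p : Nat.Primes => b p)
    (hv : ∀ p : ℕ, p.Prime → ∀ s, 0 ≤ s → ‖v p s‖ ≤ b p)
    (hlim : ∀ p : ℕ, p.Prime → Tendsto (v p) (nhdsWithin 0 (Set.Ioi 0)) (nhds (v p 0))) :
    TendstoRightContinuous fun N s => ∏ p ∈ (range N).filter Nat.Prime, (1 + v p s) := by
  set v' : ℕ → ℝ → ℂ := fun n s => if n.Prime then v n s else 0 with hv'
  set b' : ℕ → ℝ := Set.indicator {p | Nat.Prime p} b with hb'
  have hsum : Summable b' :=
    (summable_subtype_iff_indicator (f := b) (s := {p | Nat.Prime p})).1 hb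
  have hbound : ∀ s, 0 ≤ s → ∀ n, ‖v' n s‖ ≤ b' n := fun s hs n => by
    by_cases hn : n.Prime
    · simpa [hv', hb', hn] using hv n hn s hs
    · simp [hv', hb', hn]
  refine ⟨fun s => ∏' n, (1 + v' n s), fun s hs => ?_, ?_⟩
  · have h := (multipliable_one_add_of_summable (hsum.of_nonneg_of_le
      (fun _ => norm_nonneg _) (hbound s hs))).hasProd.tendsto_prod_nat
    refine h.congr fun N => ?_
    beta_reduce
    rw [prod_filter]
    refine prod_congr rfl fun n _ => ?_
    by_cases hn : n.Prime <;> simp [hv', hn]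
  · refine tendsto_tprod_one_add_of_dominated_convergence (bound := b') hsum (fun n => ?_) ?_
    · by_cases hn : n.Prime
      · simpa [hv', hn] using hlim n hn
      · simp [hv', hn]
    · filter_upwards [self_mem_nhdsWithin] with s (hs : 0 < s) n using hbound s hs.le n

lemma tendstoRightContinuous_sum_mul_rpow {z : ℕ → ℂ} {K : ℝ}
    (hK : ∀ n, ‖∑ i ∈ range n, z i * (Real.log i : ℂ)‖ ≤ K) (hz0 : z 0 = 0) (hz1 : z 1 = 0) :
    TendstoRightContinuous fun N s => ∑ n ∈ range N, z n * (((n : ℝ) ^ (-s) : ℝ) : ℂ) := by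
  set U : ℕ → ℝ → ℂ := fun N s => ∑ n ∈ range N, z n * (((n : ℝ) ^ (-s) : ℝ) : ℂ) with hU
  have htail : ∀ s, 0 ≤ s → ∀ m n : ℕ, 2 ≤ m → m ≤ n →
      ‖U n s - U m s‖ ≤ 2 * K * (Real.log m)⁻¹ := fun s hs m n hm hmn => by
    have hlog : ∀ i, m ≤ i → 0 < Real.log i := fun i hi =>
      Real.log_pos (by exact_mod_cast (by omega : 1 < i))
    have hpos : ∀ i, m ≤ i → (0 : ℝ) < i := fun i hi => by exact_mod_cast (by omega : 0 < i)
    have hK0 : 0 ≤ K := (norm_nonneg _).trans (hK 0)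
    have h := norm_sum_Ico_smul_le_of_antitone (f := fun i : ℕ => (i : ℝ) ^ (-s) * (Real.log i)⁻¹)
      (z := fun i => z i * (Real.log i : ℂ)) (K := K) (m := m) (fun i hi => ?_) (fun i hi => ?_)
      hK hmn
    · have h1 : ∑ i ∈ Ico m n, (((i : ℝ) ^ (-s) * (Real.log i)⁻¹ : ℝ) : ℂ) *
          (z i * (Real.log i : ℂ)) = U n s - U m s := by
        rw [hU, ← sum_Ico_eq_sub _ hmn]
        refine sum_congr rfl fun i hi => ?_
        have hl : (Real.log i : ℂ) ≠ 0 := by exact_mod_cast (hlog i (mem_Ico.1 hi).1).ne'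
        rw [Complex.ofReal_mul, Complex.ofReal_inv]
        field_simp
      rw [h1] at h
      refine h.trans (mul_le_mul_of_nonneg_left ?_ (by positivity))
      exact mul_le_of_le_one_left (inv_nonneg.2 (hlog m le_rfl).le)
        (Real.rpow_le_one_of_one_le_of_nonpos (by exact_mod_cast (by omega : 1 ≤ m)) (by linarith))
    · have hi1 : (i : ℝ) ≤ ((i + 1 : ℕ) : ℝ) := by exact_mod_cast Nat.le_succ i
      exact mul_le_mul (Real.rpow_le_rpow_of_nonpos (hpos i hi) hi1 (by linarith))
        (inv_anti₀ (hlog i hi) (Real.log_le_log (hpos i hi) hi1))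
        (inv_nonneg.2 (hlog _ (by omega)).le) (Real.rpow_nonneg (hpos i hi).le _)
    · exact mul_nonneg (Real.rpow_nonneg (hpos i hi).le _) (inv_nonneg.2 (hlog i hi).le)
  have hlim : Tendsto (fun m : ℕ => 2 * K * (Real.log m)⁻¹) atTop (nhds 0) := by
    simpa using (Real.tendsto_log_atTop.comp tendsto_natCast_atTop_atTop).inv_tendsto_atTop.const_mul
      (2 * K)
  have hcauchy : UniformCauchySeqOn U atTop (Set.Ici 0) := by
    rw [Metric.uniformCauchySeqOn_iff]
    intro ε hε
    obtain ⟨N, hN, hN2⟩ := ((hlim.eventually (gt_mem_nhds (half_pos hε))).and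
      (eventually_ge_atTop 2)).exists
    refine ⟨N, fun m hm n hn s hs => ?_⟩
    have h1 := htail s hs N m hN2 hm
    have h2 := htail s hs N n hN2 hn
    rw [dist_eq_norm, show U m s - U n s = (U m s - U N s) - (U n s - U N s) by ring]
    linarith [norm_sub_le (U m s - U N s) (U n s - U N s)]
  have hex : ∀ s, ∃ l, 0 ≤ s → Tendsto (fun N => U N s) atTop (nhds l) := fun s => by
    by_cases hs : 0 ≤ s
    · obtain ⟨l, hl⟩ := cauchySeq_tendsto_of_complete (hcauchy.cauchySeq hs)
      exact ⟨l, fun _ => hl⟩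
    · exact ⟨0, fun h => absurd h hs⟩
  choose Φ hΦ using hex
  refine ⟨Φ, hΦ, ?_⟩
  have hcont : ContinuousOn Φ (Set.Ici 0) := by
    refine (hcauchy.tendstoUniformlyOn_of_tendsto fun s hs => hΦ s hs).continuousOn
      (Frequently.of_forall fun N => Continuous.continuousOn ?_)
    refine continuous_finsetSum _ fun n _ => ?_
    rcases lt_or_ge n 2 with hn | hn
    · interval_cases n <;> simp [hz0, hz1, continuous_const]
    · exact continuous_const.mul (Complex.continuous_ofReal.comp
        ((Real.continuous_const_rpow (by positivity)).comp continuous_neg))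
  exact (hcont 0 Set.self_mem_Ici).mono_left (nhdsWithin_mono _ Set.Ioi_subset_Ici_self)

lemma norm_one_add_mul_exp_neg_sub_one_le {α b : ℂ} {A : ℝ} (hα : ‖α‖ ≤ A) :
    ‖(1 + α + b) * Complex.exp (-α) - 1‖ ≤
      Real.exp A * Real.exp A * ‖α‖ ^ 2 + Real.exp A * ‖b‖ := by
  have hE : ‖Complex.exp (-α)‖ ≤ Real.exp A := by
    refine (Complex.norm_exp_le_exp_norm _).trans (Real.exp_le_exp.2 ?_)
    rwa [norm_neg]
  have h2 : ‖Complex.exp α - (1 + α)‖ ≤ ‖α‖ ^ 2 * Real.exp A := by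
    have h := Complex.norm_exp_sub_sum_le_norm_mul_exp α 2
    simp only [sum_range_succ, range_zero, sum_empty, pow_zero, Nat.factorial_zero, Nat.cast_one,
      div_one, zero_add, pow_one, Nat.factorial_one] at h
    exact h.trans (mul_le_mul_of_nonneg_left (Real.exp_le_exp.2 hα) (by positivity))
  have h3 : (1 + α + b) * Complex.exp (-α) - 1 =
      -((Complex.exp α - (1 + α)) * Complex.exp (-α)) + b * Complex.exp (-α) := by
    have : Complex.exp α * Complex.exp (-α) = 1 := by
      rw [← Complex.exp_add, add_neg_cancel, Complex.exp_zero]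
    linear_combination this
  rw [h3]
  refine (norm_add_le _ _).trans ?_
  rw [norm_neg, norm_mul, norm_mul]
  have h4 := mul_le_mul h2 hE (norm_nonneg _) (by positivity)
  have h5 := mul_le_mul_of_nonneg_left hE (norm_nonneg b)
  linarith

lemma norm_one_sub_cpow_mul_exp_sub_one_le (κ : ℂ) {y : ℝ} (hy0 : 0 ≤ y) (hy : y ≤ 1 / 2) :
    ‖(1 - (y : ℂ)) ^ κ * Complex.exp (κ * y) - 1‖ ≤ ‖κ‖ * Real.exp ‖κ‖ * y ^ 2 := by
  have hny : ‖-(y : ℂ)‖ = y := by rw [norm_neg, Complex.norm_real, Real.norm_of_nonneg hy0]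
  have h1 := Complex.norm_log_one_add_sub_self_le (z := -(y : ℂ)) (by rw [hny]; linarith)
  rw [hny, ← sub_eq_add_neg, sub_neg_eq_add] at h1
  have h2 : ‖Complex.log (1 - (y : ℂ)) + y‖ ≤ y ^ 2 := by
    refine h1.trans ?_
    have h3 : (1 - y)⁻¹ ≤ 2 := by
      rw [inv_le_comm₀ (by linarith) two_pos]; linarith
    nlinarith [mul_le_mul_of_nonneg_left h3 (sq_nonneg y)]
  have hne : (1 - (y : ℂ)) ≠ 0 := by
    exact_mod_cast (by linarith : (0 : ℝ) < 1 - y).ne'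
  rw [Complex.cpow_def_of_ne_zero hne, ← Complex.exp_add,
    show Complex.log (1 - (y : ℂ)) * κ + κ * y = κ * (Complex.log (1 - (y : ℂ)) + y) by ring]
  have h3 := Complex.norm_exp_sub_sum_le_norm_mul_exp (κ * (Complex.log (1 - (y : ℂ)) + y)) 1
  simp only [sum_range_one, pow_zero, Nat.factorial_zero, Nat.cast_one, div_one, pow_one] at h3
  refine h3.trans ?_
  have h4 : ‖κ * (Complex.log (1 - (y : ℂ)) + y)‖ ≤ ‖κ‖ * y ^ 2 := by
    rw [norm_mul]; exact mul_le_mul_of_nonneg_left h2 (norm_nonneg _)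
  have h5 : ‖κ‖ * y ^ 2 ≤ ‖κ‖ := mul_le_of_le_one_right (norm_nonneg _) (by nlinarith)
  calc _ ≤ (‖κ‖ * y ^ 2) * Real.exp ‖κ‖ :=
        mul_le_mul h4 (Real.exp_le_exp.2 (h4.trans h5)) (Real.exp_pos _).le (by positivity)
    _ = _ := by ring

lemma exists_norm_sum_prime_sub_mul_log_le {a : ℕ → ℂ} {κ : ℂ}
    (hmertens : ∃ C : ℝ, ∀ w : ℝ, 2 ≤ w →
      ‖(∑ p ∈ (range (⌊w⌋₊ + 1)).filter Nat.Prime, a p * (Real.log p : ℂ))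
        - κ * (Real.log w : ℂ)‖ ≤ C) :
    ∃ K, ∀ n : ℕ, ‖∑ p ∈ (range n).filter Nat.Prime,
      (a p - κ / p) * (Real.log p : ℂ)‖ ≤ K := by
  obtain ⟨C, hC⟩ := hmertens
  obtain ⟨C₁, hC₁⟩ := exists_abs_sum_log_div_prime_sub_log_le
  have hC0 : 0 ≤ C := (norm_nonneg _).trans (hC 2 le_rfl)
  have hC₁0 : 0 ≤ C₁ := (abs_nonneg _).trans (hC₁ 1 le_rfl)
  refine ⟨C + ‖κ‖ * C₁, fun n => ?_⟩
  rcases Nat.lt_or_ge n 3 with hn | hn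
  · have : (range n).filter Nat.Prime = ∅ := by
      refine filter_eq_empty_iff.2 fun p hp hpp => ?_
      have := hpp.two_le
      have := mem_range.1 hp
      omega
    rw [this, sum_empty, norm_zero]
    positivity
  · obtain ⟨m, rfl⟩ : ∃ m, n = m + 1 := ⟨n - 1, by omega⟩
    have h1 := hC m (by exact_mod_cast (by omega : 2 ≤ m))
    have h2 := hC₁ m (by omega)
    rw [Nat.floor_natCast] at h1
    have h3 : ∑ p ∈ (range (m + 1)).filter Nat.Prime, (a p - κ / p) * (Real.log p : ℂ) =
        ((∑ p ∈ (range (m + 1)).filter Nat.Prime, a p * (Real.log p : ℂ))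
          - κ * (Real.log m : ℂ)) -
        κ * ((∑ p ∈ (range (m + 1)).filter Nat.Prime, Real.log p / p - Real.log m : ℝ) : ℂ) := by
      rw [Complex.ofReal_sub, Complex.ofReal_sum, mul_sub, mul_sum, sub_sub_sub_cancel_right,
        ← sum_sub_distrib]
      refine sum_congr rfl fun p _ => ?_
      push_cast
      ring
    rw [h3]
    refine (norm_sub_le _ _).trans (add_le_add h1 ?_)
    rw [norm_mul, Complex.norm_real, Real.norm_eq_abs]
    exact mul_le_mul_of_nonneg_left h2 (norm_nonneg _)

lemma tendstoRightContinuous_eulerProduct {a : ℕ → ℂ} (ha1 : a 1 = 1) {κ : ℂ}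
    (hmertens : ∃ C : ℝ, ∀ w : ℝ, 2 ≤ w →
      ‖(∑ p ∈ (range (⌊w⌋₊ + 1)).filter Nat.Prime, a p * (Real.log p : ℂ))
        - κ * (Real.log w : ℂ)‖ ≤ C)
    (hinner : ∀ p : Nat.Primes, Summable fun r : ℕ => ‖a ((p : ℕ) ^ (r + 2))‖)
    (hsum : Summable fun p : Nat.Primes => ∑' r : ℕ, ‖a ((p : ℕ) ^ (r + 2))‖)
    (hsq : Summable fun p : Nat.Primes => ‖a p‖ ^ 2) :
    TendstoRightContinuous fun N s => ∏ p ∈ (range N).filter Nat.Prime,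
      (1 - (((p : ℝ) ^ (-s) / p : ℝ) : ℂ)) ^ κ *
        ∑' r : ℕ, a (p ^ r) * (((p : ℝ) ^ (-s) : ℝ) : ℂ) ^ r := by
  set t : ℕ → ℝ → ℝ := fun p s => (p : ℝ) ^ (-s) with ht
  set F : ℕ → ℝ → ℂ := fun p s => ∑' r : ℕ, a (p ^ r) * (t p s : ℂ) ^ r with hF
  have ht0 : ∀ p s, 0 ≤ t p s := fun p s => Real.rpow_nonneg (Nat.cast_nonneg p) _
  have ht1 : ∀ p : ℕ, p.Prime → ∀ s, 0 ≤ s → t p s ≤ 1 := fun p hp s hs =>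
    Real.rpow_le_one_of_one_le_of_nonpos (by exact_mod_cast hp.one_lt.le) (by linarith)
  have htc : ∀ p : ℕ, p.Prime → Continuous (t p) := fun p hp =>
    (Real.continuous_const_rpow (by exact_mod_cast hp.ne_zero)).comp continuous_neg
  have hnt : ∀ p : ℕ, p.Prime → ∀ s, 0 ≤ s → ∀ r, ‖a (p ^ r) * (t p s : ℂ) ^ r‖ ≤ ‖a (p ^ r)‖ :=
    fun p hp s hs r => by
      rw [norm_mul, norm_pow, Complex.norm_real, Real.norm_of_nonneg (ht0 p s)]
      exact mul_le_of_le_one_right (norm_nonneg _) (pow_le_one₀ (ht0 p s) (ht1 p hp s hs))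
  have hsa : ∀ p : ℕ, p.Prime → Summable fun r : ℕ => ‖a (p ^ r)‖ := fun p hp =>
    (summable_nat_add_iff (f := fun r : ℕ => ‖a (p ^ r)‖) 2).1 (hinner ⟨p, hp⟩)
  have hFlim : ∀ p : ℕ, p.Prime → Tendsto (F p) (nhdsWithin 0 (Set.Ioi 0)) (nhds (F p 0)) :=
    fun p hp => by
      refine tendsto_tsum_of_dominated_convergence (bound := fun r : ℕ => ‖a (p ^ r)‖) (hsa p hp)
        (fun r => ?_) ?_
      · have hc : Continuous fun s => a (p ^ r) * (t p s : ℂ) ^ r :=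
          continuous_const.mul ((Complex.continuous_ofReal.comp (htc p hp)).pow r)
        exact (hc.tendsto 0).mono_left nhdsWithin_le_nhds
      · filter_upwards [self_mem_nhdsWithin] with s (hs : 0 < s) r using hnt p hp s hs.le r
  obtain ⟨A, hA⟩ : ∃ A, ∀ p : ℕ, p.Prime → ‖a p‖ ≤ A := by
    refine ⟨1 + ∑' p : Nat.Primes, ‖a p‖ ^ 2, fun p hp => ?_⟩
    have := hsq.le_tsum ⟨p, hp⟩ fun _ _ => by positivity
    simp only at this
    nlinarith [sq_nonneg (‖a p‖ - 1)]
  have hna : ∀ p : ℕ, p.Prime → ∀ s, 0 ≤ s → ‖a p * t p s‖ ≤ ‖a p‖ := fun p hp s hs => by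
    simpa using hnt p hp s hs 1
  -- the factors `F_p(s) exp(-a(p) p^{-s})`
  have hV : TendstoRightContinuous fun N s => ∏ p ∈ (range N).filter Nat.Prime,
      (1 + (F p s * Complex.exp (-(a p * t p s)) - 1)) := by
    refine tendstoRightContinuous_prod_one_add
      (b := fun p => Real.exp A * Real.exp A * ‖a p‖ ^ 2 +
        Real.exp A * ∑' r : ℕ, ‖a (p ^ (r + 2))‖)
      ((hsq.mul_left _).add (hsum.mul_left _)) (fun p hp s hs => ?_) (fun p hp => ?_)
    · have hs' : Summable fun r : ℕ => a (p ^ r) * (t p s : ℂ) ^ r :=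
        ((hsa p hp).of_nonneg_of_le (fun _ => norm_nonneg _) (hnt p hp s hs)).of_norm
      have h1 : F p s = 1 + a p * t p s +
          ∑' r : ℕ, a (p ^ (r + 2)) * (t p s : ℂ) ^ (r + 2) := by
        rw [hF]
        beta_reduce
        rw [← hs'.sum_add_tsum_nat_add 2]
        simp [sum_range_succ, ha1]
      have h2 : ‖∑' r : ℕ, a (p ^ (r + 2)) * (t p s : ℂ) ^ (r + 2)‖ ≤
          ∑' r : ℕ, ‖a (p ^ (r + 2))‖ :=
        tsum_of_norm_bounded (hinner ⟨p, hp⟩).hasSum fun r => hnt p hp s hs (r + 2)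
      rw [h1]
      refine (norm_one_add_mul_exp_neg_sub_one_le ((hna p hp s hs).trans (hA p hp))).trans ?_
      have h3 := hna p hp s hs
      gcongr
    · have hc : Continuous fun s => Complex.exp (-(a p * t p s)) :=
        Complex.continuous_exp.comp
          (continuous_const.mul (Complex.continuous_ofReal.comp (htc p hp))).neg
      exact ((hFlim p hp).mul ((hc.tendsto 0).mono_left nhdsWithin_le_nhds)).sub_const 1
  have hy0 : ∀ p s, 0 ≤ t p s / p := fun p s => div_nonneg (ht0 p s) (Nat.cast_nonneg p)
  have hyp : ∀ p : ℕ, p.Prime → ∀ s, 0 ≤ s → t p s / p ≤ 1 / p := fun p hp s hs =>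
    div_le_div_of_nonneg_right (ht1 p hp s hs) (Nat.cast_nonneg p)
  have hy : ∀ p : ℕ, p.Prime → ∀ s, 0 ≤ s → t p s / p ≤ 1 / 2 := fun p hp s hs =>
    (hyp p hp s hs).trans (one_div_le_one_div_of_le two_pos (by exact_mod_cast hp.two_le))
  -- the factors `(1 - p^{-1-s})^κ exp(κ p^{-1-s})`
  have hW : TendstoRightContinuous fun N s => ∏ p ∈ (range N).filter Nat.Prime,
      (1 + ((1 - ((t p s / p : ℝ) : ℂ)) ^ κ * Complex.exp (κ * ((t p s / p : ℝ) : ℂ)) - 1)) := by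
    refine tendstoRightContinuous_prod_one_add
      (b := fun p => ‖κ‖ * Real.exp ‖κ‖ * (1 / (p : ℝ) ^ 2)) ?_ (fun p hp s hs => ?_)
      (fun p hp => ?_)
    · have h : Summable fun n : ℕ => 1 / (n : ℝ) ^ 2 := Real.summable_one_div_nat_pow.2 one_lt_two
      exact (h.subtype {p | Nat.Prime p}).mul_left _
    · refine (norm_one_sub_cpow_mul_exp_sub_one_le κ (hy0 p s) (hy p hp s hs)).trans ?_
      have h1 : (t p s / p) ^ 2 ≤ 1 / (p : ℝ) ^ 2 := by
        have := pow_le_pow_left₀ (hy0 p s) (hyp p hp s hs) 2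
        rwa [div_pow 1, one_pow] at this
      gcongr
    · have hc : Continuous fun s => ((t p s / p : ℝ) : ℂ) :=
        Complex.continuous_ofReal.comp ((htc p hp).div_const _)
      have hc1 : ContinuousAt (fun s => (1 - ((t p s / p : ℝ) : ℂ)) ^ κ) 0 := by
        refine (continuous_const.sub hc).continuousAt.cpow continuousAt_const (Or.inl ?_)
        rw [Pi.sub_apply, Complex.sub_re, Complex.one_re, Complex.ofReal_re]
        linarith [hy p hp 0 le_rfl]
      have hc2 : Continuous fun s => Complex.exp (κ * ((t p s / p : ℝ) : ℂ)) :=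
        Complex.continuous_exp.comp (continuous_const.mul hc)
      exact ((hc1.mul hc2.continuousAt).sub continuousAt_const).tendsto.mono_left
        nhdsWithin_le_nhds
  obtain ⟨K, hK⟩ := exists_norm_sum_prime_sub_mul_log_le hmertens
  -- the factors `exp((a(p) - κ/p) p^{-s})`
  have hU := (tendstoRightContinuous_sum_mul_rpow
    (z := fun n => if n.Prime then a n - κ / n else 0) (K := K) (fun n => by
      refine le_of_eq_of_le (congrArg _ ?_) (hK n)
      rw [sum_filter]
      refine sum_congr rfl fun i _ => ?_
      split_ifs <;> simp) (if_neg Nat.not_prime_zero) (if_neg Nat.not_prime_one)).cexp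
  obtain ⟨Φ, h1, h2⟩ := (hU.mul hV).mul hW
  refine ⟨Φ, fun s hs => (h1 s hs).congr fun N => ?_, h2⟩
  have h3 : ∑ n ∈ range N, (if n.Prime then a n - κ / n else 0) * (((n : ℝ) ^ (-s) : ℝ) : ℂ) =
      ∑ p ∈ (range N).filter Nat.Prime, (a p - κ / p) * (t p s : ℂ) := by
    rw [sum_filter]
    refine sum_congr rfl fun i _ => ?_
    split_ifs <;> simp [ht]
  beta_reduce
  rw [h3, Complex.exp_sum, ← prod_mul_distrib, ← prod_mul_distrib]
  refine prod_congr rfl fun p _ => ?_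
  have h4 : Complex.exp ((a p - κ / p) * (t p s : ℂ)) * Complex.exp (-(a p * t p s)) *
      Complex.exp (κ * ((t p s / p : ℝ) : ℂ)) = 1 := by
    rw [← Complex.exp_add, ← Complex.exp_add, ← Complex.exp_zero]
    congr 1
    push_cast
    ring
  linear_combination (1 - ((t p s / p : ℝ) : ℂ)) ^ κ * F p s * h4

lemma prod_ofReal_cpow {ι : Type*} (S : Finset ι) {f : ι → ℝ} (hf : ∀ i ∈ S, 0 ≤ f i) (κ : ℂ) :
    ∏ i ∈ S, (f i : ℂ) ^ κ = ((∏ i ∈ S, f i : ℝ) : ℂ) ^ κ := by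
  classical
  induction S using Finset.induction_on with
  | empty => simp
  | insert i S hi ih =>
    rw [prod_insert hi, prod_insert hi, ih fun j hj => hf j (mem_insert_of_mem hj),
      Complex.ofReal_mul, Complex.mul_cpow_ofReal_nonneg (hf i (mem_insert_self i S))
        (prod_nonneg fun j hj => hf j (mem_insert_of_mem hj))]

lemma exists_tendsto_prod_one_sub_cpow (κ : ℂ) {s : ℝ} (hs : 0 < s) :
    ∃ ρ : ℝ, 0 < ρ ∧ (ρ : ℂ) = (riemannZeta (1 + s))⁻¹ ∧
      Tendsto (fun N => ∏ p ∈ (range N).filter Nat.Prime,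
        (1 - (((p : ℝ) ^ (-s) / p : ℝ) : ℂ)) ^ κ) atTop (nhds ((ρ : ℂ) ^ κ)) := by
  have hre : (1 + (s : ℂ)).re = 1 + s := by simp
  have hζ : riemannZeta (1 + s) ≠ 0 := riemannZeta_ne_zero_of_one_le_re (by rw [hre]; linarith)
  set f : ℕ → ℝ := fun p => 1 - (p : ℝ) ^ (-s) / p with hf
  set R : ℕ → ℝ := fun N => ∏ p ∈ (range N).filter Nat.Prime, f p with hR
  have hf0 : ∀ p : ℕ, p.Prime → 0 ≤ f p := fun p hp => by
    have hp1 : (1 : ℝ) ≤ p := by exact_mod_cast hp.one_lt.le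
    rw [hf, sub_nonneg, div_le_one (by linarith)]
    exact (Real.rpow_le_one_of_one_le_of_nonpos hp1 (by linarith)).trans hp1
  have hlim : Tendsto (fun N => (R N : ℂ)) atTop (nhds (riemannZeta (1 + s))⁻¹) := by
    refine ((riemannZeta_eulerProduct (s := 1 + s) (by rw [hre]; linarith)).inv₀ hζ).congr
      fun N => ?_
    rw [← prod_inv_distrib, hR, Complex.ofReal_prod]
    refine prod_congr rfl fun p hp => ?_
    have hp0 : (p : ℂ) ≠ 0 := by exact_mod_cast (Nat.prime_of_mem_primesBelow hp).ne_zero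
    rw [inv_inv, hf, Complex.ofReal_sub, Complex.ofReal_one, Complex.ofReal_div,
      Complex.ofReal_cpow (Nat.cast_nonneg p), neg_add, add_comm, Complex.cpow_add _ _ hp0,
      Complex.cpow_neg_one, div_eq_mul_inv]
    push_cast
    rfl
  have hR0 : ∀ N, 0 ≤ R N := fun N => prod_nonneg fun p hp => hf0 p (mem_filter.1 hp).2
  have hlre : Tendsto R atTop (nhds ((riemannZeta (1 + s))⁻¹).re) := by
    exact ((Complex.continuous_re.tendsto _).comp hlim).congr fun N => Complex.ofReal_re _
  have heq : ((((riemannZeta (1 + s))⁻¹).re : ℝ) : ℂ) = (riemannZeta (1 + s))⁻¹ :=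
    tendsto_nhds_unique ((Complex.continuous_ofReal.tendsto _).comp hlre) hlim
  have hpos : 0 < ((riemannZeta (1 + s))⁻¹).re :=
    lt_of_le_of_ne (ge_of_tendsto' hlre hR0) fun h => inv_ne_zero hζ (by rw [← heq, ← h]; simp)
  refine ⟨_, hpos, heq, ?_⟩
  have hc : ContinuousAt (fun z : ℂ => z ^ κ) ((((riemannZeta (1 + s))⁻¹).re : ℝ) : ℂ) :=
    continuousAt_id.cpow continuousAt_const (Or.inl (by simpa using hpos))
  refine (hc.tendsto.comp ((Complex.continuous_ofReal.tendsto _).comp hlre)).congr fun N => ?_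
  simp only [Function.comp_apply, hR]
  rw [← prod_ofReal_cpow _ fun p hp => hf0 p (mem_filter.1 hp).2]
  refine prod_congr rfl fun p _ => ?_
  rw [hf, Complex.ofReal_sub, Complex.ofReal_one]

lemma tendsto_prod_tsum_LSeries {a : ℕ → ℂ} (ha0 : a 0 = 0) (ha1 : a 1 = 1)
    (hmul : ∀ m n : ℕ, Nat.Coprime m n → a (m * n) = a m * a n) {s : ℝ}
    (hs : LSeriesSummable a s) :
    Tendsto (fun N => ∏ p ∈ (range N).filter Nat.Prime,
      ∑' r : ℕ, a (p ^ r) * (((p : ℝ) ^ (-s) : ℝ) : ℂ) ^ r) atTop (nhds (LSeries a s)) := by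
  have hterm : LSeries.term a s = fun n => a n * (((n : ℝ) ^ (-s) : ℝ) : ℂ) := by
    ext n
    rcases eq_or_ne n 0 with rfl | hn
    · simp [ha0]
    · rw [LSeries.term_of_ne_zero hn, div_eq_mul_inv, Complex.ofReal_cpow (Nat.cast_nonneg n),
        ← Complex.cpow_neg]
      push_cast
      rfl
  have h := EulerProduct.eulerProduct (f := LSeries.term a s) (by simp [ha1])
    (fun {m n} hmn => ?_) hs.norm (by simp)
  · refine h.congr fun N => prod_congr rfl fun p _ => tsum_congr fun r => ?_
    simp only [hterm]
    rw [Nat.cast_pow, ← Complex.ofReal_pow, ← Real.rpow_natCast, ← Real.rpow_mul (Nat.cast_nonneg p),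
      ← Real.rpow_natCast, ← Real.rpow_mul (Nat.cast_nonneg p), mul_comm (r : ℝ)]
  · simp only [hterm]
    rw [hmul m n hmn, Nat.cast_mul, Real.mul_rpow (Nat.cast_nonneg m) (Nat.cast_nonneg n)]
    push_cast
    ring

lemma tendsto_prod_one_sub_cpow_mul_tsum {a : ℕ → ℂ} (ha0 : a 0 = 0) (ha1 : a 1 = 1)
    (hmul : ∀ m n : ℕ, Nat.Coprime m n → a (m * n) = a m * a n) {κ : ℂ}
    (hmertens : ∃ C : ℝ, ∀ w : ℝ, 2 ≤ w →
      ‖(∑ p ∈ (range (⌊w⌋₊ + 1)).filter Nat.Prime, a p * (Real.log p : ℂ))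
        - κ * (Real.log w : ℂ)‖ ≤ C)
    (hinner : ∀ p : Nat.Primes, Summable fun r : ℕ => ‖a ((p : ℕ) ^ (r + 2))‖)
    (hsum : Summable fun p : Nat.Primes => ∑' r : ℕ, ‖a ((p : ℕ) ^ (r + 2))‖)
    (hsq : Summable fun p : Nat.Primes => ‖a p‖ ^ 2) {β D K : ℝ} {c : ℂ}
    (hβ0 : 0 ≤ β) (hβ : β < κ.re + 1)
    (hD : ∀ x : ℝ, 2 ≤ x → ∑ m ∈ Icc 1 ⌊x⌋₊, ‖a m‖ ≤ D * Real.log x ^ β)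
    (hM : ∀ x : ℝ, 2 ≤ x →
      ‖(∑ n ∈ Icc 1 ⌊x⌋₊, a n) - c * (Real.log x : ℂ) ^ κ‖ ≤ K * Real.log x ^ (β - 1)) :
    Tendsto (fun N : ℕ => ∏ p ∈ (range N).filter Nat.Prime,
      (1 - 1 / (p : ℂ)) ^ κ * ∑' r : ℕ, a (p ^ r)) atTop (nhds (Complex.Gamma (κ + 1) * c)) := by
  obtain ⟨Φ, h1, h2⟩ := tendstoRightContinuous_eulerProduct ha1 hmertens hinner hsum hsq
  have hL := tendsto_cpow_mul_LSeries ha1 hβ0 hβ hD hM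
  have hΦ : ∀ s : ℝ, 0 < s →
      Φ s = ((s * riemannZeta (1 + s))⁻¹) ^ κ * ((s : ℂ) ^ κ * LSeries a s) := fun s hs => by
    obtain ⟨ρ, hρ, hρζ, hρlim⟩ := exists_tendsto_prod_one_sub_cpow κ hs
    have h := hρlim.mul (tendsto_prod_tsum_LSeries ha0 ha1 hmul (LSeries_eq_integral_exp hD hs).1)
    have h3 : Φ s = (ρ : ℂ) ^ κ * LSeries a s := by
      refine tendsto_nhds_unique (h1 s hs.le) (h.congr fun N => ?_)
      rw [← prod_mul_distrib]
    have h4 : (s * riemannZeta (1 + s))⁻¹ = ((ρ / s : ℝ) : ℂ) := by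
      rw [mul_inv, ← hρζ, Complex.ofReal_div]
      ring
    rw [h3, h4, ← mul_assoc, ← Complex.mul_cpow_ofReal_nonneg (div_pos hρ hs).le hs.le,
      ← Complex.ofReal_mul, div_mul_cancel₀ _ hs.ne']
  have hres : Tendsto (fun s : ℝ => (s * riemannZeta (1 + s))⁻¹ ^ κ) (nhdsWithin 0 (Set.Ioi 0))
      (nhds 1) := by
    have h3 : Tendsto (fun s : ℝ => 1 + (s : ℂ)) (nhdsWithin 0 (Set.Ioi 0))
        (nhdsWithin 1 {1}ᶜ) := by
      refine tendsto_nhdsWithin_iff.2 ⟨?_, ?_⟩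
      · have hc : Continuous fun s : ℝ => 1 + (s : ℂ) := by fun_prop
        have := hc.tendsto 0
        rw [Complex.ofReal_zero, add_zero] at this
        exact this.mono_left nhdsWithin_le_nhds
      · filter_upwards [self_mem_nhdsWithin] with s (hs : 0 < s)
        simpa using hs.ne'
    have h4 := (riemannZeta_residue_one.comp h3).inv₀ one_ne_zero
    have h5 : ContinuousAt (fun z : ℂ => z ^ κ) (1⁻¹ : ℂ) :=
      continuousAt_id.cpow continuousAt_const (Or.inl (by simp))
    have h6 := h5.tendsto.comp h4
    rw [inv_one, Complex.one_cpow] at h6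
    refine h6.congr fun s => ?_
    simp
  have hΦ0 : Φ 0 = Complex.Gamma (κ + 1) * c := by
    refine tendsto_nhds_unique h2 ?_
    have h := hres.mul hL
    rw [one_mul] at h
    refine h.congr' ?_
    filter_upwards [self_mem_nhdsWithin] with s (hs : 0 < s)
    exact (hΦ s hs).symm
  rw [← hΦ0]
  refine (h1 0 le_rfl).congr fun N => prod_congr rfl fun p _ => ?_
  simp

/-- Proposition A: the mean value theorem for multiplicative
functions: under hypotheses (i)–(iii), `∑_{n≤x} g(n)/n = c(g)(log x)^κ +
O((log x)^{β−1})`, with `c(g) = Γ(κ+1)⁻¹ ∏_p (1−1/p)^κ (1 + g(p)/p + ⋯)`,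
the product converging. -/
theorem stmt_9 (g : ℕ → ℂ) (hg1 : g 1 = 1)
    (hmul : ∀ m n : ℕ, Nat.Coprime m n → g (m * n) = g m * g n)
    (κ : ℂ) (hκ : κ.im ^ 2 < 2 * κ.re + 1)
    (hmertens : ∃ C : ℝ, ∀ w : ℝ, 2 ≤ w →
      ‖(∑ p ∈ (Finset.range (⌊w⌋₊ + 1)).filter Nat.Prime,
          g p * (Real.log p : ℂ) / (p : ℂ)) - κ * (Real.log w : ℂ)‖ ≤ C)
    (hinner1 : ∀ p : Nat.Primes,
      Summable (fun r : ℕ => ‖g ((p : ℕ) ^ (r + 1))‖ / ((p : ℕ) : ℝ) ^ (r + 1)))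
    (hsum1 : Summable (fun p : Nat.Primes =>
      ‖g (p : ℕ)‖ * Real.log (p : ℕ) / (p : ℕ) *
        ∑' r : ℕ, ‖g ((p : ℕ) ^ (r + 1))‖ / ((p : ℕ) : ℝ) ^ (r + 1)))
    (hinner2 : ∀ p : Nat.Primes, Summable (fun r : ℕ =>
      ‖g ((p : ℕ) ^ (r + 2))‖ * Real.log (((p : ℕ) : ℝ) ^ (r + 2)) / ((p : ℕ) : ℝ) ^ (r + 2)))
    (hsum2 : Summable (fun p : Nat.Primes =>
      ∑' r : ℕ, ‖g ((p : ℕ) ^ (r + 2))‖ * Real.log (((p : ℕ) : ℝ) ^ (r + 2)) / ((p : ℕ) : ℝ) ^ (r + 2)))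
    (β : ℝ) (hβ0 : 0 ≤ β) (hβ : β < κ.re + 1)
    (hprod : ∃ C : ℝ, ∀ x : ℝ, 2 ≤ x →
      ∏ p ∈ (Finset.range (⌊x⌋₊ + 1)).filter Nat.Prime, (1 + ‖g p‖ / p)
        ≤ C * Real.log x ^ β) :
    ∃ c : ℂ,
      Tendsto (fun N : ℕ =>
          ∏ p ∈ (Finset.range N).filter Nat.Prime,
            (1 - 1 / (p : ℂ)) ^ κ * ∑' r : ℕ, g (p ^ r) / ((p : ℂ) ^ r))
        atTop (nhds (Complex.Gamma (κ + 1) * c)) ∧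
      ∃ C : ℝ, ∀ x : ℝ, 2 ≤ x →
        ‖(∑ n ∈ Finset.Icc 1 ⌊x⌋₊, g n / (n : ℂ)) - c * (Real.log x : ℂ) ^ κ‖
          ≤ C * Real.log x ^ (β - 1) := by
  set a : ℕ → ℂ := fun n => g n / n with ha
  have ha0 : a 0 = 0 := by simp [ha]
  have ha1 : a 1 = 1 := by simp [ha, hg1]
  have hamul : ∀ m n : ℕ, Nat.Coprime m n → a (m * n) = a m * a n := fun m n hmn => by
    simp only [ha]
    rw [hmul m n hmn, Nat.cast_mul, mul_div_mul_comm]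
  have hna : ∀ n : ℕ, ‖a n‖ = ‖g n‖ / n := fun n => by simp [ha]
  have hnap : ∀ p r : ℕ, ‖a (p ^ r)‖ = ‖g (p ^ r)‖ / (p : ℝ) ^ r := fun p r => by
    rw [hna, Nat.cast_pow]
  have hM : ∃ C : ℝ, ∀ w : ℝ, 2 ≤ w →
      ‖(∑ p ∈ (range (⌊w⌋₊ + 1)).filter Nat.Prime, a p * (Real.log p : ℂ))
        - κ * (Real.log w : ℂ)‖ ≤ C := by
    obtain ⟨C, hC⟩ := hmertens
    refine ⟨C, fun w hw => ?_⟩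
    simpa only [ha, div_mul_eq_mul_div] using hC w hw
  have hi1 : ∀ p : Nat.Primes, Summable fun r : ℕ => ‖a ((p : ℕ) ^ (r + 1))‖ := fun p => by
    simpa only [hnap] using hinner1 p
  have hs1 : Summable fun p : Nat.Primes =>
      ‖a p‖ * Real.log p * ∑' r : ℕ, ‖a ((p : ℕ) ^ (r + 1))‖ := by
    simpa only [hnap, hna, div_mul_eq_mul_div] using hsum1
  have hi2 : ∀ p : Nat.Primes, Summable fun r : ℕ =>
      ‖a ((p : ℕ) ^ (r + 2))‖ * Real.log ((p : ℝ) ^ (r + 2)) := fun p => by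
    simpa only [hnap, div_mul_eq_mul_div] using hinner2 p
  have hs2 : Summable fun p : Nat.Primes => ∑' r : ℕ,
      ‖a ((p : ℕ) ^ (r + 2))‖ * Real.log ((p : ℝ) ^ (r + 2)) := by
    simpa only [hnap, div_mul_eq_mul_div] using hsum2
  have hi : ∀ p : Nat.Primes, Summable fun r : ℕ => ‖a ((p : ℕ) ^ (r + 2))‖ := fun p =>
    (summable_nat_add_iff (f := fun r : ℕ => ‖a ((p : ℕ) ^ (r + 1))‖) 1).2 (hi1 p)
  have hlog1 : ∀ (p : Nat.Primes) (r : ℕ), 1 ≤ Real.log ((p : ℝ) ^ (r + 2)) := fun p r => by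
    have hp2 : (2 : ℝ) ≤ (p : ℕ) := by exact_mod_cast p.2.two_le
    have h1 := Real.log_le_log two_pos hp2
    have h2 := Real.log_two_gt_d9
    rw [Real.log_pow]
    have h3 : (2 : ℝ) ≤ ((r + 2 : ℕ) : ℝ) := by exact_mod_cast Nat.le_add_left 2 r
    nlinarith
  have hs : Summable fun p : Nat.Primes => ∑' r : ℕ, ‖a ((p : ℕ) ^ (r + 2))‖ :=
    hs2.of_nonneg_of_le (fun p => tsum_nonneg fun _ => norm_nonneg _) fun p =>
      (hi p).tsum_le_tsum (fun r => le_mul_of_one_le_right (norm_nonneg _) (hlog1 p r)) (hi2 p)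
  have hsq : Summable fun p : Nat.Primes => ‖a p‖ ^ 2 := by
    refine (hs1.mul_left 2).of_nonneg_of_le (fun p => by positivity) fun p => ?_
    have h1 := (hi1 p).le_tsum 0 fun _ _ => norm_nonneg _
    rw [zero_add, pow_one] at h1
    have hp2 : (2 : ℝ) ≤ (p : ℕ) := by exact_mod_cast p.2.two_le
    have h2 := Real.log_le_log two_pos hp2
    have h3 := Real.log_two_gt_d9
    have h4 : 1 ≤ 2 * Real.log (p : ℕ) := by linarith
    calc ‖a p‖ ^ 2 = ‖a p‖ * ‖a p‖ := sq _
      _ ≤ ‖a p‖ * ∑' r : ℕ, ‖a ((p : ℕ) ^ (r + 1))‖ :=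
          mul_le_mul_of_nonneg_left h1 (norm_nonneg _)
      _ ≤ (2 * Real.log (p : ℕ)) * (‖a p‖ * ∑' r : ℕ, ‖a ((p : ℕ) ^ (r + 1))‖) :=
          le_mul_of_one_le_left (mul_nonneg (norm_nonneg _) (tsum_nonneg fun _ => norm_nonneg _)) h4
      _ = _ := by ring
  obtain ⟨D₁, hD₁0, hD₁⟩ := exists_sum_norm_le_prod ha1 hamul hi hs
  obtain ⟨C₁, hC₁⟩ := hprod
  have hD : ∀ x : ℝ, 2 ≤ x → ∑ m ∈ Icc 1 ⌊x⌋₊, ‖a m‖ ≤ D₁ * C₁ * Real.log x ^ β := fun x hx => by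
    refine (hD₁ ⌊x⌋₊).trans ?_
    rw [mul_assoc]
    refine mul_le_mul_of_nonneg_left ?_ hD₁0
    simpa only [hna] using hC₁ x hx
  obtain ⟨D₂, hD₂⟩ := exists_norm_sum_mul_log_sub_logWeightedSum_le ha1 hamul hM hi1 hs1 hi2 hs2
  obtain ⟨c, K, hK⟩ := exists_sum_sub_mul_log_cpow_le a κ β hβ (C := |D₂| * (D₁ * C₁))
    fun x hx => by
      refine (hD₂ x hx).trans ?_
      rw [mul_assoc]
      exact mul_le_mul (le_abs_self _) (hD x hx) (sum_nonneg fun _ _ => norm_nonneg _)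
        (abs_nonneg _)
  refine ⟨c, ?_, K, hK⟩
  refine (tendsto_prod_one_sub_cpow_mul_tsum ha0 ha1 hamul hM hi hs hsq hβ0 hβ hD hK).congr
    fun N => prod_congr rfl fun p _ => ?_
  simp only [ha, Nat.cast_pow]
end

section
/- Under the hypotheses of the main mean value theorem (g multiplicative, ∑_{p≤w} g(p)(log p)/p = κ log w + O(1) with η² < 2ξ+1, conditions (ii),(iii) with β < ξ+1), one has ∑_{n<x} g(n) ≪ x (log x)^{β−1} for all x ≥ 2. -/
open Finset

lemma sum_range_log_sub_log_le (N : ℕ) :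
    ∑ k ∈ range N, (Real.log N - Real.log k) ≤ 2 * N := by
  induction N with
  | zero => simp
  | succ N ih =>
    rcases Nat.eq_zero_or_pos N with rfl | hN
    · simp
    have hN' : (0 : ℝ) < N := by exact_mod_cast hN
    have hd : Real.log (N + 1 : ℝ) - Real.log N ≤ 1 / N := by
      rw [← Real.log_div (by positivity) hN'.ne']
      refine (Real.log_le_sub_one_of_pos (by positivity)).trans_eq ?_
      field_simp
      ring
    have hs : ∑ k ∈ range N, (Real.log (N + 1 : ℝ) - Real.log k)
        = ∑ k ∈ range N, (Real.log N - Real.log k)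
          + N * (Real.log (N + 1 : ℝ) - Real.log N) := by
      simp only [sum_sub_distrib, sum_const, card_range, nsmul_eq_mul]
      ring
    rw [sum_range_succ]
    push_cast
    rw [hs]
    have h1 : N * (Real.log (N + 1 : ℝ) - Real.log N) ≤ 1 := by
      calc N * (Real.log (N + 1 : ℝ) - Real.log N) ≤ N * (1 / N : ℝ) := by gcongr
        _ = 1 := by field_simp
    have h2 : (1 : ℝ) / N ≤ 1 := by
      rw [div_le_one hN']
      exact_mod_cast hN
    linarith

lemma sum_range_natCast_mul_eq (b : ℕ → ℂ) (N : ℕ) :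
    ∑ n ∈ range (N + 1), (n : ℂ) * b n
      = ∑ k ∈ range N, (∑ n ∈ range (N + 1), b n - ∑ n ∈ range (k + 1), b n) := by
  induction N with
  | zero => simp
  | succ N ih =>
    rw [sum_range_succ _ (N + 1), ih, sum_range_succ
      (fun k => ∑ n ∈ range (N + 1 + 1), b n - ∑ n ∈ range (k + 1), b n) N,
      sum_range_succ b (N + 1)]
    simp only [sum_sub_distrib, sum_const, card_range, nsmul_eq_mul]
    push_cast
    ring

lemma norm_sum_range_natCast_mul_le {b : ℕ → ℂ} {κ : ℂ} {C : ℝ}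
    (h : ∀ N : ℕ, ‖∑ n ∈ range (N + 1), b n - κ * (Real.log N : ℂ)‖ ≤ C) (N : ℕ) :
    ‖∑ n ∈ range (N + 1), (n : ℂ) * b n‖ ≤ (2 * C + 2 * ‖κ‖) * N := by
  rw [sum_range_natCast_mul_eq]
  calc ‖∑ k ∈ range N, (∑ n ∈ range (N + 1), b n - ∑ n ∈ range (k + 1), b n)‖
      ≤ ∑ k ∈ range N, (2 * C + ‖κ‖ * (Real.log N - Real.log k)) := by
        refine norm_sum_le_of_le _ fun k hk => ?_
        have hlog : Real.log k ≤ Real.log N := by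
          rcases Nat.eq_zero_or_pos k with rfl | hk0
          · simpa using Real.log_natCast_nonneg N
          · exact Real.log_le_log (by exact_mod_cast hk0)
              (by exact_mod_cast (mem_range.1 hk).le)
        have hκ : ‖κ * ((Real.log N - Real.log k : ℝ) : ℂ)‖
            = ‖κ‖ * (Real.log N - Real.log k) := by
          rw [norm_mul, Complex.norm_real, Real.norm_of_nonneg (by linarith)]
        have he : ∑ n ∈ range (N + 1), b n - ∑ n ∈ range (k + 1), b n
            = (∑ n ∈ range (N + 1), b n - κ * (Real.log N : ℂ))
              - (∑ n ∈ range (k + 1), b n - κ * (Real.log k : ℂ))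
              + κ * ((Real.log N - Real.log k : ℝ) : ℂ) := by
          push_cast
          ring
        rw [he]
        refine (norm_add_le _ _).trans ?_
        have := norm_sub_le (∑ n ∈ range (N + 1), b n - κ * (Real.log N : ℂ))
          (∑ n ∈ range (k + 1), b n - κ * (Real.log k : ℂ))
        have h1 := h N
        have h2 := h k
        rw [hκ]
        linarith
    _ = 2 * C * N + ‖κ‖ * ∑ k ∈ range N, (Real.log N - Real.log k) := by
        rw [sum_add_distrib, mul_sum, sum_const, card_range, nsmul_eq_mul]
        ring
    _ ≤ 2 * C * N + ‖κ‖ * (2 * N) := by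
        gcongr
        exact sum_range_log_sub_log_le N
    _ = _ := by ring

lemma norm_sum_prime_mul_log_le {g : ℕ → ℂ} {κ : ℂ} {C : ℝ}
    (h : ∀ w : ℝ, 2 ≤ w → ‖(∑ p ∈ (range (⌊w⌋₊ + 1)).filter Nat.Prime,
      g p * (Real.log p : ℂ) / (p : ℂ)) - κ * (Real.log w : ℂ)‖ ≤ C) (N : ℕ) :
    ‖∑ p ∈ (range (N + 1)).filter Nat.Prime, g p * (Real.log p : ℂ)‖
      ≤ (2 * C + 2 * ‖κ‖) * N := by
  have hC : 0 ≤ C := (norm_nonneg _).trans (h 2 le_rfl)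
  have key := norm_sum_range_natCast_mul_le (κ := κ) (C := C)
    (b := fun p => if p.Prime then g p * (Real.log p : ℂ) / (p : ℂ) else 0) ?_ N
  · convert key using 2
    rw [sum_filter]
    refine sum_congr rfl fun p _ => ?_
    split_ifs with hp
    · have : (p : ℂ) ≠ 0 := by exact_mod_cast hp.ne_zero
      field_simp
    · simp
  · intro n
    rw [← sum_filter]
    rcases lt_or_ge n 2 with hn | hn
    · interval_cases n
      · simpa [sum_filter] using hC
      · simpa [sum_filter, sum_range_succ, Nat.not_prime_one] using hC
    · simpa using h n (by exact_mod_cast hn)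

lemma sum_Ico_le_prod_primesBelow {f : ℕ → ℝ} (hf : ∀ n, 0 ≤ f n) (hf1 : f 1 = 1)
    (hmul : ∀ {m n : ℕ}, Nat.Coprime m n → f (m * n) = f m * f n)
    (hs : ∀ {p : ℕ}, p.Prime → Summable fun r : ℕ => f (p ^ r)) (K : ℕ) :
    ∑ n ∈ Ico 1 K, f n ≤ ∏ p ∈ K.primesBelow, ∑' r : ℕ, f (p ^ r) := by
  have hsum := (EulerProduct.summable_and_hasSum_smoothNumbers_prod_primesBelow_tsum hf1 hmul
    (fun hp => (hs hp).norm) K).2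
  have hle := sum_le_hasSum ((Ico 1 K).subtype (· ∈ K.smoothNumbers)) (fun n _ => hf n) hsum
  rwa [sum_subtype_of_mem] at hle
  intro n hn
  rw [mem_Ico] at hn
  rw [Nat.mem_smoothNumbers_iff_forall_le]
  exact ⟨by omega, fun p hp _ _ => by omega⟩

lemma sum_filter_factorization_le {f w : ℕ → ℝ} (hf : ∀ n, 0 ≤ f n) (hw : ∀ n, 0 ≤ w n)
    (hmul : ∀ {m n : ℕ}, Nat.Coprime m n → f (m * n) = f m * f n)
    {p : ℕ} (hp : p.Prime) (j K : ℕ) :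
    ∑ n ∈ Ico 1 K with j ≤ n.factorization p, f n * w (n.factorization p)
      ≤ (∑ r ∈ range K, f (p ^ (r + j)) * w (r + j)) * ∑ m ∈ Ico 1 K, f m := by
  classical
  let e : ℕ → ℕ × ℕ := fun n => (n.factorization p - j, n / p ^ n.factorization p)
  let F : ℕ × ℕ → ℝ := fun q => f (p ^ (q.1 + j)) * w (q.1 + j) * f q.2
  have hinj : Set.InjOn e (Finset.filter (fun n => j ≤ n.factorization p) (Ico 1 K)) := by
    intro a ha b hb hab
    simp only [coe_filter, Set.mem_ofPred_eq] at ha hb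
    simp only [e, Prod.mk.injEq] at hab
    have hv : a.factorization p = b.factorization p := by omega
    rw [← Nat.ordProj_mul_ordCompl_eq_self a p, ← Nat.ordProj_mul_ordCompl_eq_self b p,
      hab.2, hv]
  have hval : ∀ n ∈ Finset.filter (fun n => j ≤ n.factorization p) (Ico 1 K),
      f n * w (n.factorization p) = F (e n) := by
    intro n hn
    rw [mem_filter, mem_Ico] at hn
    have hcop : Nat.Coprime (p ^ n.factorization p) (n / p ^ n.factorization p) :=
      (Nat.coprime_ordCompl hp (by omega)).pow_left _
    simp only [F, e, Nat.sub_add_cancel hn.2]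
    conv_lhs => rw [← Nat.ordProj_mul_ordCompl_eq_self n p, hmul hcop]
    rw [Nat.ordProj_mul_ordCompl_eq_self n p]
    ring
  rw [sum_congr rfl hval, ← sum_image (f := F) hinj, sum_mul_sum, ← sum_product']
  refine sum_le_sum_of_subset_of_nonneg ?_ fun q _ _ =>
    mul_nonneg (mul_nonneg (hf _) (hw _)) (hf _)
  intro q hq
  obtain ⟨n, hn, rfl⟩ := mem_image.1 hq
  rw [mem_filter, mem_Ico] at hn
  have h0 : n ≠ 0 := by omega
  have h1 := Nat.factorization_lt p h0
  have h2 := Nat.ordCompl_pos p h0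
  have h3 := Nat.ordCompl_le n p
  simp only [e, mem_product, mem_range, mem_Ico]
  omega

lemma sum_primesBelow_le_tsum {a : ℕ → ℝ} (ha : ∀ p : Nat.Primes, 0 ≤ a p)
    (hs : Summable fun p : Nat.Primes => a p) (K : ℕ) :
    ∑ p ∈ K.primesBelow, a p ≤ ∑' p : Nat.Primes, a p := by
  let s : Finset Nat.Primes := K.primesBelow.subtype Nat.Prime
  have h := hs.sum_le_tsum s fun p _ => ha p
  refine le_trans (le_of_eq ?_) h
  refine (sum_subtype_of_mem a fun p hp => ?_).symm
  exact Nat.prime_of_mem_primesBelow hp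

lemma sum_factorization_eq_one_eq {g : ℕ → ℂ}
    (hmul : ∀ m n : ℕ, Nat.Coprime m n → g (m * n) = g m * g n)
    {p : ℕ} (hp : p.Prime) (K : ℕ) :
    ∑ n ∈ Ico 1 K with n.factorization p = 1, g n
      = ∑ m ∈ Ico 1 K with p * m < K ∧ ¬ p ∣ m, g p * g m := by
  refine sum_nbij' (fun n => n / p) (fun m => p * m) ?_ ?_ ?_ ?_ ?_
  · intro n hn
    simp only [mem_filter, mem_Ico] at hn ⊢
    have h0 : n ≠ 0 := by omega
    have h1 := Nat.not_dvd_ordCompl hp h0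
    have h2 := Nat.ordCompl_pos p h0
    have h3 := Nat.ordCompl_le n p
    have h4 := Nat.ordProj_mul_ordCompl_eq_self n p
    rw [hn.2, pow_one] at h1 h2 h3 h4
    exact ⟨⟨h2, by omega⟩, by omega, h1⟩
  · intro m hm
    simp only [mem_filter, mem_Ico] at hm ⊢
    have h0 : m ≠ 0 := by omega
    refine ⟨⟨Nat.mul_pos hp.pos (by omega), hm.2.1⟩, ?_⟩
    rw [Nat.factorization_mul hp.ne_zero h0]
    simp [hp.factorization_self, Nat.factorization_eq_zero_of_not_dvd hm.2.2]
  · intro n hn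
    simp only [mem_filter, mem_Ico] at hn
    have h4 := Nat.ordProj_mul_ordCompl_eq_self n p
    rwa [hn.2, pow_one] at h4
  · intro m _
    exact Nat.mul_div_cancel_left m hp.pos
  · intro n hn
    simp only [mem_filter, mem_Ico] at hn
    have h0 : n ≠ 0 := by omega
    have h4 := Nat.ordProj_mul_ordCompl_eq_self n p
    have h5 := Nat.coprime_ordCompl hp h0
    rw [hn.2, pow_one] at h4 h5
    rw [← hmul _ _ h5, h4]

lemma norm_sum_mul_log_primePow_sub_le {g : ℕ → ℂ}
    (hmul : ∀ m n : ℕ, Nat.Coprime m n → g (m * n) = g m * g n)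
    {p : ℕ} (hp : p.Prime)
    (hs1 : Summable fun r : ℕ => ‖g (p ^ (r + 1))‖ / (p : ℝ) ^ (r + 1))
    (hs2 : Summable fun r : ℕ =>
      ‖g (p ^ (r + 2))‖ * Real.log ((p : ℝ) ^ (r + 2)) / (p : ℝ) ^ (r + 2))
    {x : ℝ} {K : ℕ} (hx : 0 ≤ x) (hK : ∀ n : ℕ, n < K → (n : ℝ) ≤ x) :
    ‖∑ n ∈ Ico 1 K, g n * (Real.log ((p : ℝ) ^ n.factorization p) : ℂ)
        - ∑ m ∈ Ico 1 K with p * m < K, g p * (Real.log p : ℂ) * g m‖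
      ≤ x * (∑ m ∈ Ico 1 K, ‖g m‖ / m) *
        (‖g p‖ * Real.log p / p * ∑' r : ℕ, ‖g (p ^ (r + 1))‖ / (p : ℝ) ^ (r + 1)
          + ∑' r : ℕ, ‖g (p ^ (r + 2))‖ * Real.log ((p : ℝ) ^ (r + 2)) / (p : ℝ) ^ (r + 2)) := by
  have hp0 : (0 : ℝ) < p := by exact_mod_cast hp.pos
  have hpL : 0 ≤ Real.log p := Real.log_natCast_nonneg p
  let f : ℕ → ℝ := fun n => ‖g n‖ / n
  have hf : ∀ n, 0 ≤ f n := fun n => by positivity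
  have hfmul : ∀ {m n : ℕ}, Nat.Coprime m n → f (m * n) = f m * f n := by
    intro m n h
    simp only [f, hmul m n h, norm_mul, Nat.cast_mul]
    rw [div_mul_div_comm]
  have hgf : ∀ n ∈ Ico 1 K, ‖g n‖ ≤ x * f n := by
    intro n hn
    rw [mem_Ico] at hn
    have hn0 : (0 : ℝ) < n := by exact_mod_cast hn.1
    calc ‖g n‖ = n * f n := by simp only [f]; field_simp
      _ ≤ x * f n := mul_le_mul_of_nonneg_right (hK n hn.2) (hf n)
  have hlog : ∀ r : ℕ, 0 ≤ Real.log ((p : ℝ) ^ r) := fun r => by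
    rw [Real.log_pow]; positivity
  set D := ∑ m ∈ Ico 1 K, ‖g m‖ / m with hD
  have hD0 : 0 ≤ D := sum_nonneg fun n _ => hf n
  have hsplit : ∑ n ∈ Ico 1 K, g n * (Real.log ((p : ℝ) ^ n.factorization p) : ℂ)
      = ∑ n ∈ Ico 1 K with 2 ≤ n.factorization p,
          g n * (Real.log ((p : ℝ) ^ n.factorization p) : ℂ)
        + (Real.log p : ℂ) * ∑ n ∈ Ico 1 K with n.factorization p = 1, g n := by
    rw [mul_sum, sum_filter, sum_filter, ← sum_add_distrib]
    refine sum_congr rfl fun n _ => ?_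
    rcases Nat.lt_trichotomy (n.factorization p) 1 with h | h | h
    · have : n.factorization p = 0 := by omega
      simp [this]
    · simp [h, mul_comm]
    · have h' : 2 ≤ n.factorization p := h
      simp [h', h.ne']
  have hmain : ∑ m ∈ Ico 1 K with p * m < K, g p * (Real.log p : ℂ) * g m
      = (Real.log p : ℂ) * ∑ m ∈ Ico 1 K with p * m < K ∧ ¬ p ∣ m, g p * g m
        + ∑ m ∈ Ico 1 K with p * m < K ∧ p ∣ m, g p * (Real.log p : ℂ) * g m := by
    rw [mul_sum, sum_filter, sum_filter, sum_filter, ← sum_add_distrib]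
    refine sum_congr rfl fun m _ => ?_
    by_cases h1 : p * m < K <;> by_cases h2 : p ∣ m <;> simp [h1, h2]
    ring
  have hB : ‖∑ n ∈ Ico 1 K with 2 ≤ n.factorization p,
      g n * (Real.log ((p : ℝ) ^ n.factorization p) : ℂ)‖
      ≤ x * D * ∑' r : ℕ,
        ‖g (p ^ (r + 2))‖ * Real.log ((p : ℝ) ^ (r + 2)) / (p : ℝ) ^ (r + 2) := by
    calc _ ≤ ∑ n ∈ Ico 1 K with 2 ≤ n.factorization p,
            x * (f n * Real.log ((p : ℝ) ^ n.factorization p)) := by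
          refine norm_sum_le_of_le _ fun n hn => ?_
          rw [norm_mul, Complex.norm_real, Real.norm_of_nonneg (hlog _), ← mul_assoc]
          exact mul_le_mul_of_nonneg_right (hgf n (mem_filter.1 hn).1) (hlog _)
      _ ≤ x * ((∑ r ∈ range K, f (p ^ (r + 2)) * Real.log ((p : ℝ) ^ (r + 2))) * D) := by
          rw [← mul_sum]
          exact mul_le_mul_of_nonneg_left (sum_filter_factorization_le
            (w := fun r => Real.log ((p : ℝ) ^ r)) hf hlog hfmul hp 2 K) hx
      _ ≤ x * ((∑' r : ℕ,
          ‖g (p ^ (r + 2))‖ * Real.log ((p : ℝ) ^ (r + 2)) / (p : ℝ) ^ (r + 2)) * D) := by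
          refine mul_le_mul_of_nonneg_left (mul_le_mul_of_nonneg_right ?_ hD0) hx
          refine le_trans (le_of_eq (sum_congr rfl fun r _ => ?_))
            (hs2.sum_le_tsum (range K) fun r _ =>
              div_nonneg (mul_nonneg (norm_nonneg _) (hlog _)) (by positivity))
          simp only [f, Nat.cast_pow]
          ring
      _ = _ := by ring
  have hA : ‖∑ m ∈ Ico 1 K with p * m < K ∧ p ∣ m, g p * (Real.log p : ℂ) * g m‖
      ≤ x * D * (‖g p‖ * Real.log p / p *
        ∑' r : ℕ, ‖g (p ^ (r + 1))‖ / (p : ℝ) ^ (r + 1)) := by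
    have hc : 0 ≤ ‖g p‖ * Real.log p / p := by positivity
    calc _ ≤ ∑ m ∈ Ico 1 K with p * m < K ∧ p ∣ m,
            x * (‖g p‖ * Real.log p / p) * f m := by
          refine norm_sum_le_of_le _ fun m hm => ?_
          rw [mem_filter, mem_Ico] at hm
          have hm0 : (0 : ℝ) < m := by exact_mod_cast hm.1.1
          have hpm : (p : ℝ) * m ≤ x := by exact_mod_cast hK _ hm.2.1
          rw [norm_mul, norm_mul, Complex.norm_real, Real.norm_of_nonneg hpL]
          calc ‖g p‖ * Real.log p * ‖g m‖
              = (p * m) * (‖g p‖ * Real.log p / p * f m) := by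
                simp only [f]; field_simp
            _ ≤ x * (‖g p‖ * Real.log p / p * f m) :=
                mul_le_mul_of_nonneg_right hpm (mul_nonneg hc (hf m))
            _ = _ := by ring
      _ ≤ ∑ m ∈ Ico 1 K with 1 ≤ m.factorization p,
            x * (‖g p‖ * Real.log p / p) * (f m * 1) := by
          simp only [mul_one]
          refine sum_le_sum_of_subset_of_nonneg (fun m hm => ?_) fun m _ _ =>
            mul_nonneg (mul_nonneg hx hc) (hf m)
          rw [mem_filter, mem_Ico] at hm
          rw [mem_filter, mem_Ico]
          exact ⟨hm.1, hp.factorization_pos_of_dvd (by omega) hm.2.2⟩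
      _ ≤ x * (‖g p‖ * Real.log p / p) * ((∑ r ∈ range K, f (p ^ (r + 1)) * 1) * D) := by
          rw [← mul_sum]
          exact mul_le_mul_of_nonneg_left (sum_filter_factorization_le
            (w := fun _ => 1) hf (fun _ => zero_le_one) hfmul hp 1 K) (mul_nonneg hx hc)
      _ ≤ x * (‖g p‖ * Real.log p / p) *
          ((∑' r : ℕ, ‖g (p ^ (r + 1))‖ / (p : ℝ) ^ (r + 1)) * D) := by
          refine mul_le_mul_of_nonneg_left (mul_le_mul_of_nonneg_right ?_ hD0)
            (mul_nonneg hx hc)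
          refine le_trans (le_of_eq (sum_congr rfl fun r _ => ?_))
            (hs1.sum_le_tsum (range K) fun r _ => by positivity)
          simp only [f, Nat.cast_pow, mul_one]
      _ = _ := by ring
  rw [hsplit, hmain, sum_factorization_eq_one_eq hmul hp K]
  rw [add_comm (Finset.sum _ _) (_ * _), add_sub_add_left_eq_sub]
  refine (norm_sub_le _ _).trans ?_
  rw [mul_add, add_comm]
  exact add_le_add hA hB

lemma natCast_log_eq_sum_primesBelow {n K : ℕ} (hn : n < K) :
    Real.log n = ∑ p ∈ K.primesBelow, Real.log ((p : ℝ) ^ n.factorization p) := by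
  simp only [Real.log_pow]
  rw [Real.log_nat_eq_sum_factorization, Finsupp.sum]
  refine sum_subset (fun p hp => ?_) fun p _ hp => ?_
  · rw [Nat.support_factorization] at hp
    exact Nat.mem_primesBelow.2 ⟨(Nat.le_of_mem_primeFactors hp).trans_lt hn,
      Nat.prime_of_mem_primeFactors hp⟩
  · rw [Finsupp.notMem_support_iff] at hp
    simp [hp]

lemma norm_sum_mul_log_le {g : ℕ → ℂ}
    (hmul : ∀ m n : ℕ, Nat.Coprime m n → g (m * n) = g m * g n)
    (hs1 : ∀ p : Nat.Primes,
      Summable (fun r : ℕ => ‖g ((p : ℕ) ^ (r + 1))‖ / ((p : ℕ) : ℝ) ^ (r + 1)))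
    (hsum1 : Summable (fun p : Nat.Primes =>
      ‖g (p : ℕ)‖ * Real.log (p : ℕ) / (p : ℕ) *
        ∑' r : ℕ, ‖g ((p : ℕ) ^ (r + 1))‖ / ((p : ℕ) : ℝ) ^ (r + 1)))
    (hs2 : ∀ p : Nat.Primes, Summable (fun r : ℕ =>
      ‖g ((p : ℕ) ^ (r + 2))‖ * Real.log (((p : ℕ) : ℝ) ^ (r + 2)) / ((p : ℕ) : ℝ) ^ (r + 2)))
    (hsum2 : Summable (fun p : Nat.Primes =>
      ∑' r : ℕ, ‖g ((p : ℕ) ^ (r + 2))‖ * Real.log (((p : ℕ) : ℝ) ^ (r + 2)) /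
        ((p : ℕ) : ℝ) ^ (r + 2)))
    {A : ℝ} (hA0 : 0 ≤ A) (hA : ∀ N : ℕ,
      ‖∑ p ∈ (range (N + 1)).filter Nat.Prime, g p * (Real.log p : ℂ)‖ ≤ A * N)
    {x : ℝ} {K : ℕ} (hx : 0 ≤ x) (hK : ∀ n : ℕ, n < K → (n : ℝ) ≤ x) :
    ‖∑ n ∈ Ico 1 K, g n * (Real.log n : ℂ)‖ ≤ x * (∑ m ∈ Ico 1 K, ‖g m‖ / m) *
      (A + ((∑' p : Nat.Primes, ‖g (p : ℕ)‖ * Real.log (p : ℕ) / (p : ℕ) *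
          ∑' r : ℕ, ‖g ((p : ℕ) ^ (r + 1))‖ / ((p : ℕ) : ℝ) ^ (r + 1))
        + ∑' p : Nat.Primes, ∑' r : ℕ, ‖g ((p : ℕ) ^ (r + 2))‖ *
          Real.log (((p : ℕ) : ℝ) ^ (r + 2)) / ((p : ℕ) : ℝ) ^ (r + 2))) := by
  set D := ∑ m ∈ Ico 1 K, ‖g m‖ / m with hD
  have hD0 : 0 ≤ D := sum_nonneg fun n _ => by positivity
  have h1 : ∑ n ∈ Ico 1 K, g n * (Real.log n : ℂ)
      = ∑ p ∈ K.primesBelow, ∑ n ∈ Ico 1 K,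
        g n * (Real.log ((p : ℝ) ^ n.factorization p) : ℂ) := by
    rw [sum_comm]
    refine sum_congr rfl fun n hn => ?_
    rw [mem_Ico] at hn
    rw [natCast_log_eq_sum_primesBelow hn.2, Complex.ofReal_sum, mul_sum]
  have h2 : ∑ p ∈ K.primesBelow, ∑ m ∈ Ico 1 K with p * m < K, g p * (Real.log p : ℂ) * g m
      = ∑ m ∈ Ico 1 K, g m *
        ∑ p ∈ (range ((K - 1) / m + 1)).filter Nat.Prime, g p * (Real.log p : ℂ) := by
    simp only [sum_filter (fun m => _ * m < K)]
    rw [sum_comm]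
    refine sum_congr rfl fun m hm => ?_
    rw [mem_Ico] at hm
    rw [← sum_filter, mul_sum]
    refine sum_congr ?_ fun p _ => mul_comm _ _
    ext p
    simp only [mem_filter, Nat.mem_primesBelow, mem_range, Nat.lt_succ_iff,
      Nat.le_div_iff_mul_le hm.1]
    have := Nat.le_mul_of_pos_right p hm.1
    constructor
    · rintro ⟨⟨_, h⟩, h'⟩
      exact ⟨by omega, h⟩
    · rintro ⟨h', h⟩
      exact ⟨⟨by omega, h⟩, by omega⟩
  have h3 : ‖∑ m ∈ Ico 1 K, g m *
      ∑ p ∈ (range ((K - 1) / m + 1)).filter Nat.Prime, g p * (Real.log p : ℂ)‖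
      ≤ x * D * A := by
    calc _ ≤ ∑ m ∈ Ico 1 K, x * A * (‖g m‖ / m) := by
          refine norm_sum_le_of_le _ fun m hm => ?_
          rw [mem_Ico] at hm
          have hm0 : (0 : ℝ) < m := by exact_mod_cast hm.1
          have hle : (((K - 1) / m : ℕ) : ℝ) ≤ x / m :=
            Nat.cast_div_le.trans (by gcongr; exact hK _ (by omega))
          rw [norm_mul]
          calc _ ≤ ‖g m‖ * (A * (x / m)) := by
                gcongr
                exact (hA _).trans (by gcongr)
            _ = _ := by ring
      _ = _ := by rw [← mul_sum]; ring
  have h4 : ‖∑ p ∈ K.primesBelow, (∑ n ∈ Ico 1 K,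
        g n * (Real.log ((p : ℝ) ^ n.factorization p) : ℂ)
      - ∑ m ∈ Ico 1 K with p * m < K, g p * (Real.log p : ℂ) * g m)‖
      ≤ x * D * ((∑' p : Nat.Primes, ‖g (p : ℕ)‖ * Real.log (p : ℕ) / (p : ℕ) *
          ∑' r : ℕ, ‖g ((p : ℕ) ^ (r + 1))‖ / ((p : ℕ) : ℝ) ^ (r + 1))
        + ∑' p : Nat.Primes, ∑' r : ℕ, ‖g ((p : ℕ) ^ (r + 2))‖ *
          Real.log (((p : ℕ) : ℝ) ^ (r + 2)) / ((p : ℕ) : ℝ) ^ (r + 2)) := by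
    refine (norm_sum_le_of_le _ fun p hp => norm_sum_mul_log_primePow_sub_le hmul
      (Nat.prime_of_mem_primesBelow hp) (hs1 ⟨p, Nat.prime_of_mem_primesBelow hp⟩)
      (hs2 ⟨p, Nat.prime_of_mem_primesBelow hp⟩) hx hK).trans ?_
    rw [← mul_sum, sum_add_distrib]
    refine mul_le_mul_of_nonneg_left (add_le_add ?_ ?_) (mul_nonneg hx hD0)
    · refine sum_primesBelow_le_tsum (a := fun p => ‖g p‖ * Real.log p / p *
        ∑' r : ℕ, ‖g (p ^ (r + 1))‖ / (p : ℝ) ^ (r + 1)) (fun p => ?_) hsum1 K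
      exact mul_nonneg (div_nonneg (mul_nonneg (norm_nonneg _) (Real.log_natCast_nonneg _))
        (by positivity)) (tsum_nonneg fun r => by positivity)
    · refine sum_primesBelow_le_tsum (a := fun p => ∑' r : ℕ, ‖g (p ^ (r + 2))‖ *
        Real.log ((p : ℝ) ^ (r + 2)) / (p : ℝ) ^ (r + 2)) (fun p => ?_) hsum2 K
      refine tsum_nonneg fun r => div_nonneg (mul_nonneg (norm_nonneg _) ?_) (by positivity)
      rw [← Nat.cast_pow]
      exact Real.log_natCast_nonneg _
  rw [sum_sub_distrib, h2, ← h1] at h4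
  rw [mul_add]
  refine (norm_le_norm_add_norm_sub' _ _).trans (add_le_add h3 h4)

lemma sum_norm_div_le_exp_mul_prod {g : ℕ → ℂ} (hg1 : g 1 = 1)
    (hmul : ∀ m n : ℕ, Nat.Coprime m n → g (m * n) = g m * g n)
    (hs1 : ∀ p : Nat.Primes,
      Summable (fun r : ℕ => ‖g ((p : ℕ) ^ (r + 1))‖ / ((p : ℕ) : ℝ) ^ (r + 1)))
    (hs2 : ∀ p : Nat.Primes, Summable (fun r : ℕ =>
      ‖g ((p : ℕ) ^ (r + 2))‖ * Real.log (((p : ℕ) : ℝ) ^ (r + 2)) / ((p : ℕ) : ℝ) ^ (r + 2)))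
    (hsum2 : Summable (fun p : Nat.Primes =>
      ∑' r : ℕ, ‖g ((p : ℕ) ^ (r + 2))‖ * Real.log (((p : ℕ) : ℝ) ^ (r + 2)) /
        ((p : ℕ) : ℝ) ^ (r + 2))) (K : ℕ) :
    ∑ n ∈ Ico 1 K, ‖g n‖ / n ≤
      Real.exp (∑' p : Nat.Primes, ∑' r : ℕ, ‖g ((p : ℕ) ^ (r + 2))‖ *
          Real.log (((p : ℕ) : ℝ) ^ (r + 2)) / ((p : ℕ) : ℝ) ^ (r + 2)) *
        ∏ p ∈ K.primesBelow, (1 + ‖g p‖ / p) := by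
  let f : ℕ → ℝ := fun n => ‖g n‖ / n
  let a : ℕ → ℝ := fun p => ∑' r : ℕ, ‖g (p ^ (r + 2))‖ *
    Real.log ((p : ℝ) ^ (r + 2)) / (p : ℝ) ^ (r + 2)
  have hf : ∀ n, 0 ≤ f n := fun n => by positivity
  have hfpow : ∀ p r : ℕ, f (p ^ r) = ‖g (p ^ r)‖ / (p : ℝ) ^ r := fun p r => by
    simp only [f, Nat.cast_pow]
  have hfmul : ∀ {m n : ℕ}, Nat.Coprime m n → f (m * n) = f m * f n := by
    intro m n h
    simp only [f, hmul m n h, norm_mul, Nat.cast_mul]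
    rw [div_mul_div_comm]
  have hfs : ∀ {p : ℕ}, p.Prime → Summable fun r : ℕ => f (p ^ r) := by
    intro p hp
    rw [← summable_nat_add_iff 1]
    simpa only [hfpow] using hs1 ⟨p, hp⟩
  have ha : ∀ p : ℕ, 0 ≤ a p := by
    intro p
    refine tsum_nonneg fun r => div_nonneg (mul_nonneg (norm_nonneg _) ?_) (by positivity)
    rw [← Nat.cast_pow]
    exact Real.log_natCast_nonneg _
  have hlocal : ∀ p ∈ K.primesBelow, ∑' r : ℕ, f (p ^ r) ≤ Real.exp (a p) * (1 + f p) := by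
    intro p hp'
    have hp := Nat.prime_of_mem_primesBelow hp'
    have hp2 : (2 : ℝ) ≤ p := by exact_mod_cast hp.two_le
    have htail : ∑' r : ℕ, f (p ^ (r + 2)) ≤ a p := by
      refine ((summable_nat_add_iff 2).2 (hfs hp)).tsum_le_tsum (fun r => ?_) (hs2 ⟨p, hp⟩)
      rw [hfpow]
      have hl : 1 ≤ Real.log ((p : ℝ) ^ (r + 2)) := by
        have h2 := Real.log_two_gt_d9
        have h3 : Real.log 2 ≤ Real.log p := Real.log_le_log (by norm_num) hp2
        rw [Real.log_pow]
        push_cast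
        nlinarith [(Nat.cast_nonneg r : (0 : ℝ) ≤ r)]
      gcongr
      exact le_mul_of_one_le_right (norm_nonneg _) hl
    rw [← (hfs hp).sum_add_tsum_nat_add 2]
    simp only [sum_range_succ, sum_range_zero, pow_zero, pow_one, zero_add]
    have hf1 : f 1 = 1 := by simp [f, hg1]
    rw [hf1]
    have h1 := Real.add_one_le_exp (a p)
    have h2 := ha p
    have h3 := hf p
    nlinarith
  calc ∑ n ∈ Ico 1 K, ‖g n‖ / n
      ≤ ∏ p ∈ K.primesBelow, ∑' r : ℕ, f (p ^ r) :=
        sum_Ico_le_prod_primesBelow hf (by simp [f, hg1]) hfmul hfs K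
    _ ≤ ∏ p ∈ K.primesBelow, Real.exp (a p) * (1 + f p) :=
        prod_le_prod (fun p _ => tsum_nonneg fun r => hf _) hlocal
    _ = Real.exp (∑ p ∈ K.primesBelow, a p) * ∏ p ∈ K.primesBelow, (1 + f p) := by
        rw [prod_mul_distrib, Real.exp_sum]
    _ ≤ _ := by
        refine mul_le_mul_of_nonneg_right (Real.exp_le_exp.2 ?_)
          (prod_nonneg fun p _ => add_nonneg zero_le_one (hf p))
        exact sum_primesBelow_le_tsum (a := a) (fun p => ha p) hsum2 K

lemma norm_sum_mul_log_le_add (g : ℕ → ℂ) {x : ℝ} {K : ℕ} (hx : 0 < x)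
    (hK : ∀ n : ℕ, n < K → (n : ℝ) ≤ x) :
    ‖∑ n ∈ Ico 1 K, g n‖ * Real.log x
      ≤ ‖∑ n ∈ Ico 1 K, g n * (Real.log n : ℂ)‖ + x * ∑ n ∈ Ico 1 K, ‖g n‖ / n := by
  have hid : (∑ n ∈ Ico 1 K, g n) * (Real.log x : ℂ)
      = ∑ n ∈ Ico 1 K, g n * (Real.log n : ℂ)
        + ∑ n ∈ Ico 1 K, g n * ((Real.log x - Real.log n : ℝ) : ℂ) := by
    rw [sum_mul, ← sum_add_distrib]
    refine sum_congr rfl fun n _ => ?_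
    push_cast
    ring
  calc ‖∑ n ∈ Ico 1 K, g n‖ * Real.log x
      ≤ ‖(∑ n ∈ Ico 1 K, g n) * (Real.log x : ℂ)‖ := by
        rw [norm_mul, Complex.norm_real]
        gcongr
        exact Real.le_norm_self _
    _ ≤ ‖∑ n ∈ Ico 1 K, g n * (Real.log n : ℂ)‖
        + ‖∑ n ∈ Ico 1 K, g n * ((Real.log x - Real.log n : ℝ) : ℂ)‖ := by
        rw [hid]
        exact norm_add_le _ _
    _ ≤ _ := by
        gcongr
        rw [mul_sum]
        refine norm_sum_le_of_le _ fun n hn => ?_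
        rw [mem_Ico] at hn
        have hn0 : (0 : ℝ) < n := by exact_mod_cast hn.1
        have hlog : Real.log n ≤ Real.log x := Real.log_le_log hn0 (hK n hn.2)
        rw [norm_mul, Complex.norm_real, Real.norm_of_nonneg (by linarith),
          ← Real.log_div hx.ne' hn0.ne']
        calc ‖g n‖ * Real.log (x / n) ≤ ‖g n‖ * (x / n) := by
              gcongr
              exact Real.log_le_self (by positivity)
          _ = _ := by ring

/-- Under the hypotheses of the main mean value theorem,
`∑_{n<x} g(n) ≪ x (log x)^{β−1}` for all `x ≥ 2`. -/
theorem stmt_10 (g : ℕ → ℂ) (hg1 : g 1 = 1)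
    (hmul : ∀ m n : ℕ, Nat.Coprime m n → g (m * n) = g m * g n)
    (κ : ℂ) (hκ : κ.im ^ 2 < 2 * κ.re + 1)
    (hmertens : ∃ C : ℝ, ∀ w : ℝ, 2 ≤ w →
      ‖(∑ p ∈ (Finset.range (⌊w⌋₊ + 1)).filter Nat.Prime,
          g p * (Real.log p : ℂ) / (p : ℂ)) - κ * (Real.log w : ℂ)‖ ≤ C)
    (hinner1 : ∀ p : Nat.Primes,
      Summable (fun r : ℕ => ‖g ((p : ℕ) ^ (r + 1))‖ / ((p : ℕ) : ℝ) ^ (r + 1)))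
    (hsum1 : Summable (fun p : Nat.Primes =>
      ‖g (p : ℕ)‖ * Real.log (p : ℕ) / (p : ℕ) *
        ∑' r : ℕ, ‖g ((p : ℕ) ^ (r + 1))‖ / ((p : ℕ) : ℝ) ^ (r + 1)))
    (hinner2 : ∀ p : Nat.Primes, Summable (fun r : ℕ =>
      ‖g ((p : ℕ) ^ (r + 2))‖ * Real.log (((p : ℕ) : ℝ) ^ (r + 2)) / ((p : ℕ) : ℝ) ^ (r + 2)))
    (hsum2 : Summable (fun p : Nat.Primes =>
      ∑' r : ℕ, ‖g ((p : ℕ) ^ (r + 2))‖ * Real.log (((p : ℕ) : ℝ) ^ (r + 2)) / ((p : ℕ) : ℝ) ^ (r + 2)))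
    (β : ℝ) (hβ0 : 0 ≤ β) (hβ : β < κ.re + 1)
    (hprod : ∃ C : ℝ, ∀ x : ℝ, 2 ≤ x →
      ∏ p ∈ (Finset.range (⌊x⌋₊ + 1)).filter Nat.Prime, (1 + ‖g p‖ / p)
        ≤ C * Real.log x ^ β) :
    ∃ C : ℝ, ∀ x : ℝ, 2 ≤ x →
      ‖∑ n ∈ Finset.Ico 1 ⌈x⌉₊, g n‖ ≤ C * x * Real.log x ^ (β - 1) := by
  obtain ⟨C₀, hC₀⟩ := hmertens
  obtain ⟨C₁, hC₁⟩ := hprod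
  have hC₀0 : 0 ≤ C₀ := (norm_nonneg _).trans (hC₀ 2 le_rfl)
  set A := 2 * C₀ + 2 * ‖κ‖ with hAdef
  have hA0 : 0 ≤ A := by positivity
  have hA := norm_sum_prime_mul_log_le hC₀
  set S := ∑' p : Nat.Primes, ‖g (p : ℕ)‖ * Real.log (p : ℕ) / (p : ℕ) *
    ∑' r : ℕ, ‖g ((p : ℕ) ^ (r + 1))‖ / ((p : ℕ) : ℝ) ^ (r + 1) with hS
  set B := ∑' p : Nat.Primes, ∑' r : ℕ, ‖g ((p : ℕ) ^ (r + 2))‖ *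
    Real.log (((p : ℕ) : ℝ) ^ (r + 2)) / ((p : ℕ) : ℝ) ^ (r + 2) with hB
  have hS0 : 0 ≤ S := tsum_nonneg fun p => mul_nonneg (div_nonneg
    (mul_nonneg (norm_nonneg _) (Real.log_natCast_nonneg _)) (by positivity))
    (tsum_nonneg fun r => by positivity)
  have hB0 : 0 ≤ B := by
    refine tsum_nonneg fun p => tsum_nonneg fun r =>
      div_nonneg (mul_nonneg (norm_nonneg _) ?_) (by positivity)
    rw [← Nat.cast_pow]
    exact Real.log_natCast_nonneg _
  refine ⟨Real.exp B * C₁ * (A + (S + B) + 1), fun x hx => ?_⟩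
  have hx0 : 0 < x := by linarith
  have hL : 0 < Real.log x := Real.log_pos (by linarith)
  have hK : ∀ n : ℕ, n < ⌈x⌉₊ → (n : ℝ) ≤ x := fun n hn => (Nat.lt_ceil.1 hn).le
  have hD : ∑ n ∈ Ico 1 ⌈x⌉₊, ‖g n‖ / n ≤ Real.exp B * (C₁ * Real.log x ^ β) := by
    refine (sum_norm_div_le_exp_mul_prod hg1 hmul hinner1 hinner2 hsum2 ⌈x⌉₊).trans ?_
    refine mul_le_mul_of_nonneg_left (le_trans ?_ (hC₁ x hx)) (Real.exp_pos _).le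
    refine prod_le_prod_of_subset_of_one_le (fun p hp => ?_)
      (fun p _ => by positivity) fun p _ _ => le_add_of_nonneg_right (by positivity)
    rw [Nat.mem_primesBelow] at hp
    rw [mem_filter, mem_range]
    exact ⟨hp.1.trans_le (Nat.ceil_le_floor_add_one x), hp.2⟩
  have h1 := norm_sum_mul_log_le_add g hx0 hK
  have h2 := norm_sum_mul_log_le hmul hinner1 hsum1 hinner2 hsum2 hA0 hA hx0.le hK
  rw [Real.rpow_sub_one hL.ne', ← mul_div_assoc, le_div_iff₀ hL]
  calc _ ≤ x * (∑ n ∈ Ico 1 ⌈x⌉₊, ‖g n‖ / n) * (A + (S + B) + 1) := by linarith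
    _ ≤ x * (Real.exp B * (C₁ * Real.log x ^ β)) * (A + (S + B) + 1) := by gcongr
    _ = _ := by ring
end
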